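/- arXiv:1012.3980 — 4 statements merged into one kernel-verified Lean document; each statement's English description precedes it below -/
import Mathlib

section
/- Let k ≥ 1. For all R > 0, r ∈ (0, R), and every smooth function ζ : B_{R,r} → ℝ^k with ∫_{B_{R,r}} ζ = 0, one has ‖ζ‖₁ ≤ √(π/2) · (1 + √(ln(R/r))) · R² · ‖dζ‖₂. In particular, there is a bound of the form ‖ζ‖₁ ≤ C(R/r) R² ‖dζ‖₂ with a constant depending only on the ratio R/r. -/
open MeasureTheory Real

/-- The open annulus `B_{R,r} = B_R \ closure(B_r)` in the Euclidean plane. -/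
noncomputable def annulus (R r : ℝ) : Set (EuclideanSpace ℝ (Fin 2)) :=
  Metric.ball 0 R \ closure (Metric.ball 0 r)

/-- Wirtinger's inequality for complex-valued functions on an interval. -/
theorem integral_norm_sq_le_of_integral_eq_zero {a b : ℝ} (hab : a < b) {f f' : ℝ → ℂ}
    (hf : ∀ x, HasDerivAt f (f' x) x) (hf' : Continuous f') (hper : f b = f a)
    (h0 : ∫ x in a..b, f x = 0) :
    ∫ x in a..b, ‖f x‖ ^ 2 ≤ ((b - a) / (2 * π)) ^ 2 * ∫ x in a..b, ‖f' x‖ ^ 2 := by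
  have hba : 0 < b - a := sub_pos.2 hab
  have hfc : Continuous f := continuous_iff_continuousAt.2 fun x => (hf x).continuousAt
  have hL2 {g : ℝ → ℂ} (hg : Continuous g) : MemLp g 2 (volume.restrict (Set.Ioc a b)) :=
    (memLp_two_iff_integrable_sq_norm hg.aestronglyMeasurable).2
      (by fun_prop : Continuous fun x => ‖g x‖ ^ 2).integrableOn_Ioc
  have h1 := hasSum_sq_fourierCoeffOn hab (hL2 hfc)
  have h2 := (hasSum_sq_fourierCoeffOn hab (hL2 hf')).mul_left (((b - a) / (2 * π)) ^ 2)
  have key := hasSum_le (fun n : ℤ => ?_) h1 h2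
  · simp only [smul_eq_mul] at key
    rw [mul_left_comm] at key
    exact le_of_mul_le_mul_left key (inv_pos.2 hba)
  · rcases eq_or_ne n 0 with rfl | hn
    · have : fourierCoeffOn hab f 0 = 0 := by
        rw [fourierCoeffOn_eq_integral]
        simp [h0]
      rw [this]
      simp only [norm_zero, ne_eq, OfNat.ofNat_ne_zero, not_false_eq_true, zero_pow]
      positivity
    · rw [fourierCoeffOn_of_hasDerivAt hab hn (fun x _ => hf x) (hf'.intervalIntegrable _ _),
        hper, sub_self, mul_zero, zero_sub, ← mul_pow]
      gcongr
      have hn' : (1 : ℝ) ≤ |(n : ℝ)| := by exact_mod_cast Int.one_le_abs hn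
      have hb : ‖(b : ℂ) - a‖ = b - a := by
        rw [← Complex.ofReal_sub, Complex.norm_real, Real.norm_of_nonneg hba.le]
      simp only [norm_mul, norm_div, norm_neg, norm_one, Complex.norm_I, hb, Complex.norm_real,
        Complex.norm_intCast, Complex.norm_ofNat, Real.norm_of_nonneg pi_pos.le, mul_one]
      rw [← mul_assoc, one_div_mul_eq_div]
      refine mul_le_mul_of_nonneg_right ?_ (norm_nonneg _)
      exact div_le_div_of_nonneg_left hba.le (by positivity)
        (le_mul_of_one_le_right (by positivity) hn')

/-- Wirtinger's inequality on a period for functions with values in a Euclidean space. -/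
theorem integral_norm_sub_average_sq_le {ι : Type*} [Fintype ι]
    {f f' : ℝ → EuclideanSpace ℝ ι} (hf : ∀ x, HasDerivAt f (f' x) x) (hf' : Continuous f')
    (hper : f π = f (-π)) :
    ∫ x in -π..π, ‖f x - (2 * π)⁻¹ • ∫ y in -π..π, f y‖ ^ 2 ≤ ∫ x in -π..π, ‖f' x‖ ^ 2 := by
  have hfc : Continuous f := continuous_iff_continuousAt.2 fun x => (hf x).continuousAt
  have hpi : -π < π := by linarith [pi_pos]
  set c := (2 * π)⁻¹ • ∫ y in -π..π, f y with hc
  simp only [EuclideanSpace.norm_sq_eq]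
  rw [intervalIntegral.integral_finsetSum, intervalIntegral.integral_finsetSum]
  · refine Finset.sum_le_sum fun i _ => ?_
    have hd (x : ℝ) : HasDerivAt (fun x => ((f x - c) i : ℂ)) (f' x i : ℂ) x := by
      have := (EuclideanSpace.proj (𝕜 := ℝ) i).hasFDerivAt.comp_hasDerivAt x ((hf x).sub_const c)
      exact this.ofReal_comp
    have h := integral_norm_sq_le_of_integral_eq_zero hpi hd (by fun_prop) (by simp [hper]) ?_
    · rw [show π - -π = 2 * π by ring, div_self (by positivity), one_pow, one_mul] at h
      simpa only [Complex.norm_real] using h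
    · rw [intervalIntegral.integral_ofReal]
      have : ∫ x in -π..π, (f x - c) i = (∫ x in -π..π, (f x - c)) i :=
        (EuclideanSpace.proj (𝕜 := ℝ) i).intervalIntegral_comp_comm
          ((hfc.sub continuous_const).intervalIntegrable _ _)
      rw [this, intervalIntegral.integral_sub (hfc.intervalIntegrable _ _) (by simp),
        intervalIntegral.integral_const, show π - -π = 2 * π by ring, hc,
        smul_inv_smul₀ (by positivity)]
      simp
  · exact fun i _ => Continuous.intervalIntegrable (by fun_prop) _ _
  · exact fun i _ => Continuous.intervalIntegrable (by fun_prop) _ _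

theorem lintegral_mul_le_sqrt_mul_sqrt {α : Type*} [MeasurableSpace α] {μ : Measure α}
    {f g : α → ENNReal} (hf : AEMeasurable f μ) (hg : AEMeasurable g μ) :
    ∫⁻ a, f a * g a ∂μ ≤
      (∫⁻ a, f a ^ 2 ∂μ) ^ (1 / 2 : ℝ) * (∫⁻ a, g a ^ 2 ∂μ) ^ (1 / 2 : ℝ) := by
  simpa using ENNReal.lintegral_mul_le_Lp_mul_Lq μ Real.HolderConjugate.two_two hf hg

theorem lintegral_Ioo_ofReal {a b : ℝ} (hab : a ≤ b) {f : ℝ → ℝ}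
    (hf : ContinuousOn f (Set.Icc a b)) (h0 : ∀ x ∈ Set.Icc a b, 0 ≤ f x) :
    ∫⁻ x in Set.Ioo a b, ENNReal.ofReal (f x) = ENNReal.ofReal (∫ x in a..b, f x) := by
  rw [intervalIntegral.integral_of_le hab, integral_Ioc_eq_integral_Ioo,
    ofReal_integral_eq_lintegral_ofReal]
  · exact hf.integrableOn_Icc.mono_set Set.Ioo_subset_Icc_self
  · filter_upwards [self_mem_ae_restrict measurableSet_Ioo] with x hx
    exact h0 x (Set.Ioo_subset_Icc_self hx)

theorem ENNReal.ofReal_rpow_half {x : ℝ} (hx : 0 ≤ x) :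
    ENNReal.ofReal x ^ (1 / 2 : ℝ) = ENNReal.ofReal (√x) := by
  rw [ENNReal.ofReal_rpow_of_nonneg hx (by norm_num), Real.sqrt_eq_rpow]

theorem ENNReal.rpow_half_sq (x : ENNReal) : (x ^ (1 / 2 : ℝ)) ^ 2 = x := by
  rw [← ENNReal.rpow_natCast, ← ENNReal.rpow_mul]
  simp

/-- The contribution of the circles `{|x| = s}`, in polar coordinates. -/
theorem lintegral_angular_le {r R : ℝ} (hr : 0 < r) (hrR : r < R) {H G : ℝ → ℝ → ENNReal}
    (hG : AEMeasurable (Function.uncurry G)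
      ((volume.restrict (Set.Ioo r R)).prod (volume.restrict (Set.Ioo (-π) π))))
    (hH : ∀ s ∈ Set.Ioo r R, AEMeasurable (H s) (volume.restrict (Set.Ioo (-π) π)))
    (hHG : ∀ s ∈ Set.Ioo r R, ∫⁻ θ in Set.Ioo (-π) π, H s θ ^ 2 ≤
      ENNReal.ofReal s ^ 2 * ∫⁻ θ in Set.Ioo (-π) π, G s θ ^ 2) :
    ∫⁻ s in Set.Ioo r R, ENNReal.ofReal s * ∫⁻ θ in Set.Ioo (-π) π, H s θ ≤
      ENNReal.ofReal (√(π / 2) * R ^ 2) *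
        (∫⁻ s in Set.Ioo r R, ENNReal.ofReal s * ∫⁻ θ in Set.Ioo (-π) π, G s θ ^ 2)
          ^ (1 / 2 : ℝ) := by
  have hR : 0 < R := hr.trans hrR
  set g : ℝ → ENNReal := fun s => ∫⁻ θ in Set.Ioo (-π) π, G s θ ^ 2 with hg
  have hgm : AEMeasurable g (volume.restrict (Set.Ioo r R)) :=
    (hG.pow_const 2).lintegral_prod_right'
  have hofm : AEMeasurable (fun s : ℝ => ENNReal.ofReal s) (volume.restrict (Set.Ioo r R)) :=
    ENNReal.measurable_ofReal.aemeasurable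
  have hcirc (s : ℝ) (hs : s ∈ Set.Ioo r R) : ∫⁻ θ in Set.Ioo (-π) π, H s θ ≤
      ENNReal.ofReal (√(2 * π)) * (ENNReal.ofReal s * g s ^ (1 / 2 : ℝ)) := by
    calc ∫⁻ θ in Set.Ioo (-π) π, H s θ = ∫⁻ θ in Set.Ioo (-π) π, 1 * H s θ := by simp
      _ ≤ (∫⁻ _ in Set.Ioo (-π) π, 1 ^ 2) ^ (1 / 2 : ℝ) *
          (∫⁻ θ in Set.Ioo (-π) π, H s θ ^ 2) ^ (1 / 2 : ℝ) :=
        lintegral_mul_le_sqrt_mul_sqrt aemeasurable_const (hH s hs)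
      _ ≤ ENNReal.ofReal (2 * π) ^ (1 / 2 : ℝ) *
          (ENNReal.ofReal s ^ 2 * g s) ^ (1 / 2 : ℝ) := by
        gcongr
        · simp [show π + π = 2 * π by ring]
        · exact hHG s hs
      _ = _ := by
        rw [ENNReal.ofReal_rpow_half (by positivity), ENNReal.mul_rpow_of_nonneg _ _ (by norm_num),
          ← ENNReal.rpow_natCast, ← ENNReal.rpow_mul]
        simp
  have hcube : ∫⁻ s in Set.Ioo r R, ENNReal.ofReal s ^ 3 ≤ ENNReal.ofReal (R ^ 4 / 4) := by
    calc ∫⁻ s in Set.Ioo r R, ENNReal.ofReal s ^ 3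
        = ∫⁻ s in Set.Ioo r R, ENNReal.ofReal (s ^ 3) :=
          setLIntegral_congr_fun measurableSet_Ioo fun s hs =>
            (ENNReal.ofReal_pow (hr.trans hs.1).le 3).symm
      _ = ENNReal.ofReal (∫ s in r..R, s ^ 3) :=
          lintegral_Ioo_ofReal hrR.le (by fun_prop) fun s hs => pow_nonneg (hr.le.trans hs.1) 3
      _ ≤ _ := by
        rw [integral_pow]
        apply ENNReal.ofReal_le_ofReal
        have : 0 ≤ r ^ 4 := by positivity
        norm_num
        linarith
  calc ∫⁻ s in Set.Ioo r R, ENNReal.ofReal s * ∫⁻ θ in Set.Ioo (-π) π, H s θ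
      ≤ ∫⁻ s in Set.Ioo r R, ENNReal.ofReal (√(2 * π)) *
        (ENNReal.ofReal s ^ (3 / 2 : ℝ) * (ENNReal.ofReal s * g s) ^ (1 / 2 : ℝ)) := by
        refine setLIntegral_mono_ae' measurableSet_Ioo (.of_forall fun s hs => ?_)
        calc _ ≤ ENNReal.ofReal s *
              (ENNReal.ofReal (√(2 * π)) * (ENNReal.ofReal s * g s ^ (1 / 2 : ℝ))) := by
              gcongr
              exact hcirc s hs
          _ = ENNReal.ofReal (√(2 * π)) *
              (ENNReal.ofReal s ^ 2 * g s ^ (1 / 2 : ℝ)) := by ring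
          _ = _ := by
            have hs0 : ENNReal.ofReal s ≠ 0 := by simpa using hr.trans hs.1
            rw [ENNReal.mul_rpow_of_nonneg _ _ (by norm_num), ← mul_assoc (_ ^ (3 / 2 : ℝ)),
              ← ENNReal.rpow_add _ _ hs0 ENNReal.ofReal_ne_top]
            norm_num
    _ = ENNReal.ofReal (√(2 * π)) * ∫⁻ s in Set.Ioo r R,
        ENNReal.ofReal s ^ (3 / 2 : ℝ) * (ENNReal.ofReal s * g s) ^ (1 / 2 : ℝ) :=
        lintegral_const_mul' _ _ ENNReal.ofReal_ne_top
    _ ≤ ENNReal.ofReal (√(2 * π)) * ((∫⁻ s in Set.Ioo r R, ENNReal.ofReal s ^ 3) ^ (1 / 2 : ℝ) *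
        (∫⁻ s in Set.Ioo r R, ENNReal.ofReal s * g s) ^ (1 / 2 : ℝ)) := by
        gcongr
        refine (lintegral_mul_le_sqrt_mul_sqrt (hofm.pow_const _)
          ((hofm.mul hgm).pow_const _)).trans_eq ?_
        simp only [ENNReal.rpow_half_sq]
        simp only [← ENNReal.rpow_natCast, ← ENNReal.rpow_mul]
        norm_num
    _ ≤ ENNReal.ofReal (√(2 * π)) * (ENNReal.ofReal (R ^ 4 / 4) ^ (1 / 2 : ℝ) *
        (∫⁻ s in Set.Ioo r R, ENNReal.ofReal s * g s) ^ (1 / 2 : ℝ)) := by gcongr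
    _ = _ := by
        rw [ENNReal.ofReal_rpow_half (by positivity), ← mul_assoc,
          ← ENNReal.ofReal_mul (by positivity)]
        congr 2
        rw [show R ^ 4 / 4 = (R ^ 2 / 2) ^ 2 by ring, Real.sqrt_sq (by positivity),
          show 2 * π = 2 ^ 2 * (π / 2) by ring, Real.sqrt_mul (by positivity),
          Real.sqrt_sq (by norm_num)]
        ring

/-- The total radial variation, averaged over all directions, in polar coordinates. -/
theorem lintegral_radial_le {r R : ℝ} (hr : 0 < r) (hrR : r < R) {G : ℝ → ℝ → ENNReal}
    (hG : AEMeasurable (Function.uncurry G)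
      ((volume.restrict (Set.Ioo r R)).prod (volume.restrict (Set.Ioo (-π) π)))) :
    ∫⁻ θ in Set.Ioo (-π) π, ∫⁻ s in Set.Ioo r R, G s θ ≤
      ENNReal.ofReal (√(2 * π) * √(log (R / r))) *
        (∫⁻ s in Set.Ioo r R, ENNReal.ofReal s * ∫⁻ θ in Set.Ioo (-π) π, G s θ ^ 2)
          ^ (1 / 2 : ℝ) := by
  have hR : 0 < R := hr.trans hrR
  set g : ℝ → ENNReal := fun s => ∫⁻ θ in Set.Ioo (-π) π, G s θ ^ 2 with hg
  have hgm : AEMeasurable g (volume.restrict (Set.Ioo r R)) :=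
    (hG.pow_const 2).lintegral_prod_right'
  have hofm : AEMeasurable (fun s : ℝ => ENNReal.ofReal s) (volume.restrict (Set.Ioo r R)) :=
    ENNReal.measurable_ofReal.aemeasurable
  have hcirc : ∀ᵐ s ∂(volume.restrict (Set.Ioo r R)), ∫⁻ θ in Set.Ioo (-π) π, G s θ ≤
      ENNReal.ofReal (√(2 * π)) * g s ^ (1 / 2 : ℝ) := by
    filter_upwards [hG.aestronglyMeasurable.prodMk_left] with s hs
    calc ∫⁻ θ in Set.Ioo (-π) π, G s θ = ∫⁻ θ in Set.Ioo (-π) π, 1 * G s θ := by simp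
      _ ≤ (∫⁻ _ in Set.Ioo (-π) π, 1 ^ 2) ^ (1 / 2 : ℝ) *
          (∫⁻ θ in Set.Ioo (-π) π, G s θ ^ 2) ^ (1 / 2 : ℝ) :=
        lintegral_mul_le_sqrt_mul_sqrt aemeasurable_const hs.aemeasurable
      _ = _ := by
        rw [← ENNReal.ofReal_rpow_half (by positivity)]
        simp [show π + π = 2 * π by ring, hg]
  have hinv : ∫⁻ s in Set.Ioo r R, (ENNReal.ofReal s)⁻¹ = ENNReal.ofReal (log (R / r)) := by
    calc ∫⁻ s in Set.Ioo r R, (ENNReal.ofReal s)⁻¹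
        = ∫⁻ s in Set.Ioo r R, ENNReal.ofReal s⁻¹ :=
          setLIntegral_congr_fun measurableSet_Ioo fun s hs =>
            (ENNReal.ofReal_inv_of_pos (hr.trans hs.1)).symm
      _ = ENNReal.ofReal (∫ s in r..R, s⁻¹) :=
          lintegral_Ioo_ofReal hrR.le
            (continuousOn_inv₀.mono fun s hs => (hr.trans_le hs.1).ne')
            fun s hs => inv_nonneg.2 (hr.le.trans hs.1)
      _ = _ := by rw [integral_inv_of_pos hr hR]
  calc ∫⁻ θ in Set.Ioo (-π) π, ∫⁻ s in Set.Ioo r R, G s θ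
      = ∫⁻ s in Set.Ioo r R, ∫⁻ θ in Set.Ioo (-π) π, G s θ := (lintegral_lintegral_swap hG).symm
    _ ≤ ∫⁻ s in Set.Ioo r R, ENNReal.ofReal (√(2 * π)) * g s ^ (1 / 2 : ℝ) :=
        lintegral_mono_ae hcirc
    _ = ENNReal.ofReal (√(2 * π)) * ∫⁻ s in Set.Ioo r R, g s ^ (1 / 2 : ℝ) :=
        lintegral_const_mul' _ _ ENNReal.ofReal_ne_top
    _ = ENNReal.ofReal (√(2 * π)) * ∫⁻ s in Set.Ioo r R, (ENNReal.ofReal s)⁻¹ ^ (1 / 2 : ℝ) *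
        (ENNReal.ofReal s * g s) ^ (1 / 2 : ℝ) := by
        congr 1
        refine setLIntegral_congr_fun measurableSet_Ioo fun s hs => ?_
        have hs0 : ENNReal.ofReal s ≠ 0 := by simpa using hr.trans hs.1
        rw [← ENNReal.mul_rpow_of_nonneg _ _ (by norm_num), ← mul_assoc,
          ENNReal.inv_mul_cancel hs0 ENNReal.ofReal_ne_top, one_mul]
    _ ≤ ENNReal.ofReal (√(2 * π)) * ((∫⁻ s in Set.Ioo r R, (ENNReal.ofReal s)⁻¹) ^ (1 / 2 : ℝ) *
        (∫⁻ s in Set.Ioo r R, ENNReal.ofReal s * g s) ^ (1 / 2 : ℝ)) := by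
        gcongr
        refine (lintegral_mul_le_sqrt_mul_sqrt (hofm.inv.pow_const _)
          ((hofm.mul hgm).pow_const _)).trans_eq ?_
        simp only [ENNReal.rpow_half_sq]
        rfl
    _ = _ := by
        rw [hinv, ENNReal.ofReal_rpow_half (log_nonneg ((one_le_div hr).2 hrR.le)), ← mul_assoc,
          ← ENNReal.ofReal_mul (by positivity)]

/-- A function on an interval whose weighted mean vanishes is bounded by its oscillation. -/
theorem enorm_le_of_weighted_integral_eq_zero {E : Type*} [NormedAddCommGroup E]
    [NormedSpace ℝ E] [CompleteSpace E] {r R : ℝ} (hr : 0 < r) (hrR : r < R) {m : ℝ → E}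
    {M : ENNReal} (hm : IntegrableOn (fun s => s • m s) (Set.Ioo r R))
    (h0 : ∫ s in Set.Ioo r R, s • m s = 0)
    (hM : ∀ s ∈ Set.Ioo r R, ∀ t ∈ Set.Ioo r R, ‖m s - m t‖ₑ ≤ M) {s : ℝ}
    (hs : s ∈ Set.Ioo r R) : ‖m s‖ₑ ≤ M := by
  have hid : IntegrableOn (fun t : ℝ => t) (Set.Ioo r R) :=
    continuous_id.continuousOn.integrableOn_Icc.mono_set Set.Ioo_subset_Icc_self
  have hc : ∫ t in Set.Ioo r R, t = (R ^ 2 - r ^ 2) / 2 := by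
    rw [← integral_Ioc_eq_integral_Ioo, ← intervalIntegral.integral_of_le hrR.le, integral_id]
  have hcpos : 0 < (R ^ 2 - r ^ 2) / 2 := by nlinarith
  have hlc : ∫⁻ t in Set.Ioo r R, ENNReal.ofReal t = ENNReal.ofReal ((R ^ 2 - r ^ 2) / 2) := by
    rw [lintegral_Ioo_ofReal hrR.le (by fun_prop) fun t ht => hr.le.trans ht.1, integral_id]
  have hrep : ((R ^ 2 - r ^ 2) / 2) • m s = ∫ t in Set.Ioo r R, t • (m s - m t) := by
    simp only [smul_sub]
    rw [integral_sub (hid.smul_const _) hm, h0, sub_zero, integral_smul_const, hc]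
  have hle : ENNReal.ofReal ((R ^ 2 - r ^ 2) / 2) * ‖m s‖ₑ ≤
      ENNReal.ofReal ((R ^ 2 - r ^ 2) / 2) * M := by
    calc ENNReal.ofReal ((R ^ 2 - r ^ 2) / 2) * ‖m s‖ₑ
        = ‖((R ^ 2 - r ^ 2) / 2) • m s‖ₑ := by
          rw [enorm_smul, Real.enorm_of_nonneg hcpos.le]
      _ ≤ ∫⁻ t in Set.Ioo r R, ‖t • (m s - m t)‖ₑ := by
          rw [hrep]
          exact enorm_integral_le_lintegral_enorm _
      _ ≤ ∫⁻ t in Set.Ioo r R, ENNReal.ofReal t * M := by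
          refine setLIntegral_mono_ae' measurableSet_Ioo (.of_forall fun t ht => ?_)
          rw [enorm_smul, Real.enorm_of_nonneg (hr.trans ht.1).le]
          gcongr
          exact hM s hs t ht
      _ = _ := by rw [lintegral_mul_const _ ENNReal.measurable_ofReal, hlc]
  rwa [ENNReal.mul_le_mul_iff_right (by simpa using hcpos) ENNReal.ofReal_ne_top] at hle

/-- The Poincaré inequality on an annulus, in polar coordinates. -/
theorem lintegral_polar_poincare {E : Type*} [NormedAddCommGroup E] [NormedSpace ℝ E]
    [CompleteSpace E] {r R : ℝ} (hr : 0 < r) (hrR : r < R) {F : ℝ → ℝ → E}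
    {G : ℝ → ℝ → ENNReal}
    (hG : AEMeasurable (Function.uncurry G)
      ((volume.restrict (Set.Ioo r R)).prod (volume.restrict (Set.Ioo (-π) π))))
    (hFc : ∀ s ∈ Set.Ioo r R, Continuous (F s))
    (hFi : Integrable (fun p : ℝ × ℝ => p.1 • F p.1 p.2)
      ((volume.restrict (Set.Ioo r R)).prod (volume.restrict (Set.Ioo (-π) π))))
    (hF0 : ∫ p : ℝ × ℝ, p.1 • F p.1 p.2
      ∂((volume.restrict (Set.Ioo r R)).prod (volume.restrict (Set.Ioo (-π) π))) = 0)
    (hang : ∀ s ∈ Set.Ioo r R,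
      ∫⁻ θ in Set.Ioo (-π) π, ‖F s θ - (2 * π)⁻¹ • ∫ φ in Set.Ioo (-π) π, F s φ‖ₑ ^ 2 ≤
        ENNReal.ofReal s ^ 2 * ∫⁻ θ in Set.Ioo (-π) π, G s θ ^ 2)
    (hrad : ∀ t ∈ Set.Ioo r R, ∀ s ∈ Set.Ioo r R, t ≤ s → ∀ θ,
      ‖F s θ - F t θ‖ₑ ≤ ∫⁻ τ in Set.Ioo r R, G τ θ) :
    ∫⁻ s in Set.Ioo r R, ENNReal.ofReal s * ∫⁻ θ in Set.Ioo (-π) π, ‖F s θ‖ₑ ≤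
      ENNReal.ofReal (√(π / 2) * (1 + √(log (R / r))) * R ^ 2) *
        (∫⁻ s in Set.Ioo r R, ENNReal.ofReal s * ∫⁻ θ in Set.Ioo (-π) π, G s θ ^ 2)
          ^ (1 / 2 : ℝ) := by
  have hR : 0 < R := hr.trans hrR
  set D := (∫⁻ s in Set.Ioo r R, ENNReal.ofReal s * ∫⁻ θ in Set.Ioo (-π) π, G s θ ^ 2)
    ^ (1 / 2 : ℝ) with hD
  set m : ℝ → E := fun s => (2 * π)⁻¹ • ∫ φ in Set.Ioo (-π) π, F s φ with hm
  have hFint (s : ℝ) (hs : s ∈ Set.Ioo r R) : IntegrableOn (F s) (Set.Ioo (-π) π) :=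
    (hFc s hs).continuousOn.integrableOn_Icc.mono_set Set.Ioo_subset_Icc_self
  have hsm (s : ℝ) : s • m s = (2 * π)⁻¹ • ∫ θ in Set.Ioo (-π) π, s • F s θ := by
    rw [integral_smul, smul_comm]
  have hmi : IntegrableOn (fun s => s • m s) (Set.Ioo r R) := by
    simp only [hsm]
    exact hFi.integral_prod_left.smul _
  have hm0 : ∫ s in Set.Ioo r R, s • m s = 0 := by
    simp only [hsm]
    rw [integral_smul, ← integral_prod _ hFi, hF0, smul_zero]
  have hdiff (t : ℝ) (ht : t ∈ Set.Ioo r R) (s : ℝ) (hs : s ∈ Set.Ioo r R) (hts : t ≤ s) :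
      ‖m s - m t‖ₑ ≤ ENNReal.ofReal ((√(2 * π))⁻¹ * √(log (R / r))) * D := by
    calc ‖m s - m t‖ₑ
        = ENNReal.ofReal (2 * π)⁻¹ * ‖∫ θ in Set.Ioo (-π) π, (F s θ - F t θ)‖ₑ := by
          rw [integral_sub (hFint s hs) (hFint t ht), ← Real.enorm_of_nonneg (by positivity),
            ← enorm_smul, smul_sub]
      _ ≤ ENNReal.ofReal (2 * π)⁻¹ * ∫⁻ θ in Set.Ioo (-π) π, ‖F s θ - F t θ‖ₑ := by
          gcongr
          exact enorm_integral_le_lintegral_enorm _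
      _ ≤ ENNReal.ofReal (2 * π)⁻¹ *
          ∫⁻ θ in Set.Ioo (-π) π, ∫⁻ τ in Set.Ioo r R, G τ θ := by
          gcongr with θ
          exact hrad t ht s hs hts θ
      _ ≤ ENNReal.ofReal (2 * π)⁻¹ * (ENNReal.ofReal (√(2 * π) * √(log (R / r))) * D) := by
          gcongr
          exact lintegral_radial_le hr hrR hG
      _ = _ := by
          rw [← mul_assoc, ← ENNReal.ofReal_mul (by positivity), ← mul_assoc]
          congr 3
          rw [inv_mul_eq_div, Real.sqrt_div_self', one_div]
  have hmb (s : ℝ) (hs : s ∈ Set.Ioo r R) :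
      ‖m s‖ₑ ≤ ENNReal.ofReal ((√(2 * π))⁻¹ * √(log (R / r))) * D := by
    refine enorm_le_of_weighted_integral_eq_zero hr hrR hmi hm0 (fun s hs t ht => ?_) hs
    rcases le_total t s with h | h
    · exact hdiff t ht s hs h
    · rw [← enorm_neg, neg_sub]
      exact hdiff s hs t ht h
  have hid : ∫⁻ s in Set.Ioo r R, ENNReal.ofReal s ≤ ENNReal.ofReal (R ^ 2 / 2) := by
    rw [lintegral_Ioo_ofReal hrR.le (by fun_prop) fun t ht => hr.le.trans ht.1, integral_id]
    exact ENNReal.ofReal_le_ofReal (by nlinarith)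
  have hFm (s : ℝ) (hs : s ∈ Set.Ioo r R) : Measurable fun θ => ‖F s θ - m s‖ₑ :=
    ((hFc s hs).sub continuous_const).enorm.measurable
  calc ∫⁻ s in Set.Ioo r R, ENNReal.ofReal s * ∫⁻ θ in Set.Ioo (-π) π, ‖F s θ‖ₑ
      ≤ ∫⁻ s in Set.Ioo r R, (ENNReal.ofReal s * (∫⁻ θ in Set.Ioo (-π) π, ‖F s θ - m s‖ₑ) +
          ENNReal.ofReal s *
            (ENNReal.ofReal ((√(2 * π))⁻¹ * √(log (R / r))) * D * ENNReal.ofReal (2 * π))) := by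
        refine setLIntegral_mono_ae' measurableSet_Ioo (.of_forall fun s hs => ?_)
        rw [← mul_add]
        gcongr
        calc ∫⁻ θ in Set.Ioo (-π) π, ‖F s θ‖ₑ
            ≤ ∫⁻ θ in Set.Ioo (-π) π, (‖F s θ - m s‖ₑ +
              ENNReal.ofReal ((√(2 * π))⁻¹ * √(log (R / r))) * D) := by
              refine lintegral_mono fun θ => ?_
              calc ‖F s θ‖ₑ = ‖(F s θ - m s) + m s‖ₑ := by rw [sub_add_cancel]
                _ ≤ ‖F s θ - m s‖ₑ + ‖m s‖ₑ := enorm_add_le _ _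
                _ ≤ _ := by
                  gcongr
                  exact hmb s hs
          _ = _ := by
              rw [lintegral_add_right _ measurable_const]
              simp [show π + π = 2 * π by ring]
    _ = (∫⁻ s in Set.Ioo r R, ENNReal.ofReal s * ∫⁻ θ in Set.Ioo (-π) π, ‖F s θ - m s‖ₑ) +
          (∫⁻ s in Set.Ioo r R, ENNReal.ofReal s) *
            (ENNReal.ofReal ((√(2 * π))⁻¹ * √(log (R / r))) * D * ENNReal.ofReal (2 * π)) := by
        rw [lintegral_add_right _ (ENNReal.measurable_ofReal.mul_const _),
          lintegral_mul_const _ ENNReal.measurable_ofReal]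
    _ ≤ ENNReal.ofReal (√(π / 2) * R ^ 2) * D + ENNReal.ofReal (R ^ 2 / 2) *
          (ENNReal.ofReal ((√(2 * π))⁻¹ * √(log (R / r))) * D * ENNReal.ofReal (2 * π)) := by
        gcongr
        exact lintegral_angular_le hr hrR hG (fun s hs => (hFm s hs).aemeasurable) hang
    _ = (ENNReal.ofReal (√(π / 2) * R ^ 2) + ENNReal.ofReal
          (R ^ 2 / 2 * ((√(2 * π))⁻¹ * √(log (R / r))) * (2 * π))) * D := by
        rw [ENNReal.ofReal_mul (by positivity : 0 ≤ R ^ 2 / 2 * ((√(2 * π))⁻¹ * √(log (R / r)))),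
          ENNReal.ofReal_mul (by positivity : 0 ≤ R ^ 2 / 2)]
        ring
    _ = _ := by
        rw [← ENNReal.ofReal_add (by positivity) (by positivity)]
        congr 2
        have h1 : √(2 * π) = 2 * √(π / 2) := by
          rw [show 2 * π = 2 ^ 2 * (π / 2) by ring, Real.sqrt_mul (by positivity),
            Real.sqrt_sq (by norm_num)]
        have h2 : √(π / 2) ^ 2 = π / 2 := Real.sq_sqrt (by positivity)
        have h3 : 0 < √(π / 2) := by positivity
        rw [h1]
        field_simp
        rw [h2]
        ring

/-- Polar coordinates in the Euclidean plane. -/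
noncomputable def polarMap (s θ : ℝ) : EuclideanSpace ℝ (Fin 2) :=
  Complex.orthonormalBasisOneI.repr (s * Complex.exp (θ * Complex.I))

theorem norm_polarMap {s : ℝ} (hs : 0 ≤ s) (θ : ℝ) : ‖polarMap s θ‖ = s := by
  rw [polarMap, LinearIsometryEquiv.norm_map, norm_mul, Complex.norm_exp_ofReal_mul_I, mul_one,
    Complex.norm_real, Real.norm_of_nonneg hs]

theorem mem_annulus_iff {R r : ℝ} (hr : 0 < r) {y : EuclideanSpace ℝ (Fin 2)} :
    y ∈ annulus R r ↔ ‖y‖ ∈ Set.Ioo r R := by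
  rw [annulus, closure_ball _ hr.ne']
  simp [and_comm]

theorem isOpen_annulus (R r : ℝ) : IsOpen (annulus R r) :=
  Metric.isOpen_ball.sdiff isClosed_closure

theorem polarMap_mem_annulus {R r s : ℝ} (hr : 0 < r) (hs : s ∈ Set.Ioo r R) (θ : ℝ) :
    polarMap s θ ∈ annulus R r := by
  rwa [mem_annulus_iff hr, norm_polarMap (hr.trans hs.1).le]

theorem contDiff_polarMap : ContDiff ℝ 1 (Function.uncurry polarMap) := by
  unfold polarMap Function.uncurry
  refine (LinearIsometryEquiv.contDiff _).comp ?_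
  have h {n : ℝ × ℝ → ℝ} (hn : ContDiff ℝ 1 n) : ContDiff ℝ 1 fun p => (n p : ℂ) :=
    Complex.ofRealCLM.contDiff.comp hn
  exact (h contDiff_fst).mul ((h contDiff_snd).mul contDiff_const).cexp

theorem hasDerivAt_polarMap_angle (s θ : ℝ) :
    HasDerivAt (fun θ => polarMap s θ)
      (Complex.orthonormalBasisOneI.repr (s * (Complex.exp (θ * Complex.I) * Complex.I))) θ := by
  have h := ((Complex.ofRealCLM.hasDerivAt (x := θ)).mul_const Complex.I).cexp.const_mul (s : ℂ)
  simp only [Complex.ofRealCLM_apply, Complex.ofReal_one, one_mul] at h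
  exact Complex.orthonormalBasisOneI.repr.toContinuousLinearEquiv.hasFDerivAt.comp_hasDerivAt θ h

theorem hasDerivAt_polarMap_radius (s θ : ℝ) :
    HasDerivAt (fun s => polarMap s θ) (polarMap 1 θ) s := by
  have h := (Complex.ofRealCLM.hasDerivAt (x := s)).mul_const (Complex.exp (θ * Complex.I))
  simp only [Complex.ofRealCLM_apply] at h
  exact Complex.orthonormalBasisOneI.repr.toContinuousLinearEquiv.hasFDerivAt.comp_hasDerivAt s h

theorem polarMap_eq_polarCoord_symm (p : ℝ × ℝ) :
    Complex.orthonormalBasisOneI.repr (Complex.polarCoord.symm p) = polarMap p.1 p.2 := by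
  rw [polarMap, Complex.polarCoord_symm_apply, Complex.exp_mul_I, Complex.ofReal_cos,
    Complex.ofReal_sin]

theorem indicator_annulus_polarMap {R r : ℝ} (hr : 0 < r) {β : Type*} [Zero β]
    (f : EuclideanSpace ℝ (Fin 2) → β) {p : ℝ × ℝ} (hp : p ∈ polarCoord.target) :
    (annulus R r).indicator f (polarMap p.1 p.2) =
      (Set.Ioo r R ×ˢ Set.Ioo (-π) π).indicator (fun p => f (polarMap p.1 p.2)) p := by
  classical
  rw [polarCoord_target] at hp
  simp only [Set.indicator_apply, mem_annulus_iff hr, norm_polarMap (le_of_lt hp.1), Set.mem_prod,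
    hp.2, and_true]

theorem Ioo_prod_subset_polarCoord_target {R r : ℝ} (hr : 0 < r) :
    Set.Ioo r R ×ˢ Set.Ioo (-π) π ⊆ polarCoord.target := by
  rw [polarCoord_target]
  exact Set.prod_mono (fun s hs => hr.trans hs.1) subset_rfl

theorem volume_restrict_Ioo_prod (a b c d : ℝ) :
    (volume.restrict (Set.Ioo a b)).prod (volume.restrict (Set.Ioo c d)) =
      (volume : Measure (ℝ × ℝ)).restrict (Set.Ioo a b ×ˢ Set.Ioo c d) := by
  rw [Measure.prod_restrict, Measure.volume_eq_prod]

theorem lintegral_annulus {R r : ℝ} (hr : 0 < r) (f : EuclideanSpace ℝ (Fin 2) → ENNReal) :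
    ∫⁻ y in annulus R r, f y = ∫⁻ p : ℝ × ℝ, ENNReal.ofReal p.1 * f (polarMap p.1 p.2)
      ∂((volume.restrict (Set.Ioo r R)).prod (volume.restrict (Set.Ioo (-π) π))) := by
  have hm : MeasurableSet (Set.Ioo r R ×ˢ Set.Ioo (-π) π) :=
    measurableSet_Ioo.prod measurableSet_Ioo
  rw [← lintegral_indicator (isOpen_annulus R r).measurableSet,
    ← Complex.orthonormalBasisOneI.measurePreserving_repr.lintegral_comp_emb
      Complex.orthonormalBasisOneI.repr.toHomeomorph.measurableEmbedding,
    ← Complex.lintegral_comp_polarCoord_symm, volume_restrict_Ioo_prod,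
    ← Set.inter_eq_left.2 (Ioo_prod_subset_polarCoord_target (R := R) hr),
    ← setLIntegral_indicator hm]
  refine setLIntegral_congr_fun polarCoord.open_target.measurableSet fun p hp => ?_
  simp only [polarMap_eq_polarCoord_symm, indicator_annulus_polarMap hr f hp, smul_eq_mul]
  by_cases h : p ∈ Set.Ioo r R ×ˢ Set.Ioo (-π) π <;> simp [h]

theorem lintegral_annulus_of_continuousOn {R r : ℝ} (hr : 0 < r)
    {f : EuclideanSpace ℝ (Fin 2) → ENNReal} (hf : ContinuousOn f (annulus R r)) :
    ∫⁻ y in annulus R r, f y = ∫⁻ s in Set.Ioo r R, ENNReal.ofReal s *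
      ∫⁻ θ in Set.Ioo (-π) π, f (polarMap s θ) := by
  have hfm : AEMeasurable (fun p : ℝ × ℝ => ENNReal.ofReal p.1 * f (polarMap p.1 p.2))
      ((volume.restrict (Set.Ioo r R)).prod (volume.restrict (Set.Ioo (-π) π))) := by
    rw [volume_restrict_Ioo_prod]
    refine AEMeasurable.mul (by fun_prop) (ContinuousOn.aemeasurable
      (hf.comp contDiff_polarMap.continuous.continuousOn fun p hp => ?_)
      (measurableSet_Ioo.prod measurableSet_Ioo))
    exact polarMap_mem_annulus hr hp.1 p.2
  rw [lintegral_annulus hr, lintegral_prod _ hfm]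
  simp only [lintegral_const_mul' _ _ ENNReal.ofReal_ne_top]

theorem integral_annulus {E : Type*} [NormedAddCommGroup E] [NormedSpace ℝ E] {R r : ℝ}
    (hr : 0 < r) (f : EuclideanSpace ℝ (Fin 2) → E) :
    ∫ y in annulus R r, f y = ∫ p : ℝ × ℝ, p.1 • f (polarMap p.1 p.2)
      ∂((volume.restrict (Set.Ioo r R)).prod (volume.restrict (Set.Ioo (-π) π))) := by
  have hm : MeasurableSet (Set.Ioo r R ×ˢ Set.Ioo (-π) π) :=
    measurableSet_Ioo.prod measurableSet_Ioo
  rw [← integral_indicator (isOpen_annulus R r).measurableSet,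
    ← Complex.orthonormalBasisOneI.measurePreserving_repr.integral_comp
      Complex.orthonormalBasisOneI.repr.toHomeomorph.measurableEmbedding,
    ← Complex.integral_comp_polarCoord_symm, volume_restrict_Ioo_prod,
    ← Set.inter_eq_right.2 (Ioo_prod_subset_polarCoord_target (R := R) hr),
    ← setIntegral_indicator hm]
  refine setIntegral_congr_fun polarCoord.open_target.measurableSet fun p hp => ?_
  simp only [polarMap_eq_polarCoord_symm, indicator_annulus_polarMap hr f hp]
  by_cases h : p ∈ Set.Ioo r R ×ˢ Set.Ioo (-π) π <;> simp [h]

/-- Wirtinger's inequality on a period, for a function whose derivative is bounded by `c * g`. -/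
theorem lintegral_enorm_sub_average_sq_le {ι : Type*} [Fintype ι]
    {f f' : ℝ → EuclideanSpace ℝ ι} {g : ℝ → ENNReal} {c : ENNReal} (hc : c ≠ ⊤)
    (hf : ∀ x, HasDerivAt f (f' x) x) (hf' : Continuous f') (hper : f π = f (-π))
    (hg : ∀ x, ‖f' x‖ₑ ≤ g x * c) :
    ∫⁻ x in Set.Ioo (-π) π, ‖f x - (2 * π)⁻¹ • ∫ y in Set.Ioo (-π) π, f y‖ₑ ^ 2 ≤
      c ^ 2 * ∫⁻ x in Set.Ioo (-π) π, g x ^ 2 := by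
  have hpi : -π ≤ π := by linarith [pi_pos]
  have hfc : Continuous f := continuous_iff_continuousAt.2 fun x => (hf x).continuousAt
  have hconv (u : ℝ → EuclideanSpace ℝ ι) (hu : Continuous u) :
      ∫⁻ x in Set.Ioo (-π) π, ‖u x‖ₑ ^ 2 = ENNReal.ofReal (∫ x in -π..π, ‖u x‖ ^ 2) := by
    rw [← lintegral_Ioo_ofReal hpi (by fun_prop) fun x _ => by positivity]
    simp only [ENNReal.ofReal_pow (norm_nonneg _), ofReal_norm]
  calc _ = ENNReal.ofReal (∫ x in -π..π, ‖f x - (2 * π)⁻¹ • ∫ y in -π..π, f y‖ ^ 2) := by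
        rw [← integral_Ioc_eq_integral_Ioo, ← intervalIntegral.integral_of_le hpi]
        exact hconv (fun x => f x - _) (hfc.sub continuous_const)
    _ ≤ ENNReal.ofReal (∫ x in -π..π, ‖f' x‖ ^ 2) :=
        ENNReal.ofReal_le_ofReal (integral_norm_sub_average_sq_le hf hf' hper)
    _ = ∫⁻ x in Set.Ioo (-π) π, ‖f' x‖ₑ ^ 2 := (hconv _ hf').symm
    _ ≤ ∫⁻ x in Set.Ioo (-π) π, c ^ 2 * g x ^ 2 := by
        refine lintegral_mono fun x => ?_
        rw [← mul_pow, mul_comm c]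
        gcongr
        exact hg x
    _ = _ := lintegral_const_mul' _ _ (ENNReal.pow_ne_top hc)

theorem continuous_comp_polarMap {β : Type*} [TopologicalSpace β] {R r : ℝ} (hr : 0 < r)
    {f : EuclideanSpace ℝ (Fin 2) → β} (hf : ContinuousOn f (annulus R r)) {s : ℝ}
    (hs : s ∈ Set.Ioo r R) : Continuous fun θ => f (polarMap s θ) :=
  hf.comp_continuous
    (continuous_iff_continuousAt.2 fun θ => (hasDerivAt_polarMap_angle s θ).continuousAt)
    fun θ => polarMap_mem_annulus hr hs θ

theorem aestronglyMeasurable_comp_polarMap {β : Type*} [TopologicalSpace β]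
    [TopologicalSpace.PseudoMetrizableSpace β] [SecondCountableTopologyEither (ℝ × ℝ) β]
    {R r : ℝ} (hr : 0 < r)
    {f : EuclideanSpace ℝ (Fin 2) → β} (hf : ContinuousOn f (annulus R r)) :
    AEStronglyMeasurable (fun p : ℝ × ℝ => f (polarMap p.1 p.2))
      ((volume.restrict (Set.Ioo r R)).prod (volume.restrict (Set.Ioo (-π) π))) := by
  rw [volume_restrict_Ioo_prod]
  refine ContinuousOn.aestronglyMeasurable
    (hf.comp contDiff_polarMap.continuous.continuousOn fun p hp => ?_)
    (measurableSet_Ioo.prod measurableSet_Ioo)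
  exact polarMap_mem_annulus hr hp.1 p.2

/-- Integrability on an annulus, in polar coordinates. -/
theorem integrable_smul_comp_polarMap {E : Type*} [NormedAddCommGroup E] [NormedSpace ℝ E]
    {R r : ℝ} (hr : 0 < r) {f : EuclideanSpace ℝ (Fin 2) → E}
    (hf : ContinuousOn f (annulus R r)) (hfi : IntegrableOn f (annulus R r)) :
    Integrable (fun p : ℝ × ℝ => p.1 • f (polarMap p.1 p.2))
      ((volume.restrict (Set.Ioo r R)).prod (volume.restrict (Set.Ioo (-π) π))) := by
  refine ⟨continuous_fst.aestronglyMeasurable.smul (aestronglyMeasurable_comp_polarMap hr hf), ?_⟩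
  have h := hfi.2
  rw [hasFiniteIntegral_iff_enorm, lintegral_annulus hr] at h
  rw [hasFiniteIntegral_iff_enorm]
  refine (lintegral_congr_ae ?_).trans_lt h
  rw [volume_restrict_Ioo_prod]
  filter_upwards [self_mem_ae_restrict (measurableSet_Ioo.prod measurableSet_Ioo)] with p hp
  rw [enorm_smul, Real.enorm_of_nonneg (hr.trans hp.1.1).le]

section Gradient

variable {E : Type*} [NormedAddCommGroup E] [NormedSpace ℝ E] {R r : ℝ}
  {f : EuclideanSpace ℝ (Fin 2) → E}

theorem hasFDerivAt_polarMap (hr : 0 < r) (hf : ContDiffOn ℝ 1 f (annulus R r)) {s : ℝ}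
    (hs : s ∈ Set.Ioo r R) (θ : ℝ) :
    HasFDerivAt f (fderiv ℝ f (polarMap s θ)) (polarMap s θ) :=
  ((hf.differentiableOn one_ne_zero).differentiableAt
    ((isOpen_annulus R r).mem_nhds (polarMap_mem_annulus hr hs θ))).hasFDerivAt

/-- The oscillation along a ray is bounded by the integral of the gradient. -/
theorem enorm_polarMap_sub_polarMap_le (hr : 0 < r) (hf : ContDiffOn ℝ 1 f (annulus R r))
    {t s : ℝ} (ht : t ∈ Set.Ioo r R) (hs : s ∈ Set.Ioo r R) (hts : t ≤ s) (θ : ℝ) :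
    ‖f (polarMap s θ) - f (polarMap t θ)‖ₑ ≤
      ∫⁻ τ in Set.Ioo r R, ‖fderiv ℝ f (polarMap τ θ)‖ₑ := by
  have hIcc : Set.Icc t s ⊆ Set.Ioo r R := Set.Icc_subset_Ioo ht.1 hs.2
  have hcd : ContDiffOn ℝ 1 (fun τ => f (polarMap τ θ)) (Set.Icc t s) :=
    hf.comp (contDiff_polarMap.comp (contDiff_id.prodMk contDiff_const)).contDiffOn
      fun τ hτ => polarMap_mem_annulus hr (hIcc hτ) θ
  refine (enorm_sub_le_lintegral_deriv_of_contDiffOn_Icc hcd hts).trans ?_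
  refine le_trans ?_ (lintegral_mono_set hIcc)
  refine setLIntegral_mono_ae' measurableSet_Icc (.of_forall fun τ hτ => ?_)
  have hd : HasDerivAt (fun τ => f (polarMap τ θ))
      (fderiv ℝ f (polarMap τ θ) (polarMap 1 θ)) τ :=
    (hasFDerivAt_polarMap hr hf (hIcc hτ) θ).comp_hasDerivAt τ (hasDerivAt_polarMap_radius τ θ)
  rw [hd.deriv]
  refine (ContinuousLinearMap.le_opENorm _ _).trans_eq ?_
  rw [← ofReal_norm (polarMap 1 θ), norm_polarMap zero_le_one, ENNReal.ofReal_one, mul_one]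

/-- Wirtinger's inequality on the circle of radius `s`. -/
theorem lintegral_circle_sub_average_sq_le {ι : Type*} [Fintype ι]
    {f : EuclideanSpace ℝ (Fin 2) → EuclideanSpace ℝ ι} (hr : 0 < r)
    (hf : ContDiffOn ℝ 1 f (annulus R r)) {s : ℝ} (hs : s ∈ Set.Ioo r R) :
    ∫⁻ θ in Set.Ioo (-π) π, ‖f (polarMap s θ) -
        (2 * π)⁻¹ • ∫ φ in Set.Ioo (-π) π, f (polarMap s φ)‖ₑ ^ 2 ≤
      ENNReal.ofReal s ^ 2 * ∫⁻ θ in Set.Ioo (-π) π, ‖fderiv ℝ f (polarMap s θ)‖ₑ ^ 2 := by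
  refine lintegral_enorm_sub_average_sq_le ENNReal.ofReal_ne_top
    (fun θ => (hasFDerivAt_polarMap hr hf hs θ).comp_hasDerivAt θ
      (hasDerivAt_polarMap_angle s θ)) ?_ ?_ fun θ => ?_
  · have h1 : Continuous fun θ : ℝ => fderiv ℝ f (polarMap s θ) :=
      continuous_comp_polarMap hr
        (hf.continuousOn_fderiv_of_isOpen (isOpen_annulus R r) le_rfl) hs
    exact h1.clm_apply (by fun_prop)
  · simp [polarMap, Complex.exp_neg]
  · refine (ContinuousLinearMap.le_opENorm _ _).trans_eq ?_
    congr 1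
    rw [← ofReal_norm, LinearIsometryEquiv.norm_map, norm_mul, norm_mul,
      Complex.norm_exp_ofReal_mul_I, Complex.norm_I, Complex.norm_real,
      Real.norm_of_nonneg (hr.trans hs.1).le, one_mul, mul_one]

end Gradient

/-- **Poincaré-type inequality on an annulus with a ratio-dependent constant.**
If `ζ : B_{R,r} → ℝ^k` is smooth with `∫_{B_{R,r}} ζ = 0`, then
`‖ζ‖₁ ≤ √(π/2) (1 + √(ln(R/r))) R² ‖dζ‖₂`. -/
theorem stmt1 (k : ℕ) (hk : 1 ≤ k) (R r : ℝ) (hR : 0 < R) (hr : r ∈ Set.Ioo 0 R)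
    (ζ : EuclideanSpace ℝ (Fin 2) → EuclideanSpace ℝ (Fin k))
    (hζ : ContDiffOn ℝ (⊤ : ℕ∞) ζ (annulus R r))
    (hζint : IntegrableOn ζ (annulus R r))
    (hint : (∫ y in annulus R r, ζ y) = 0) :
    eLpNorm ζ 1 (volume.restrict (annulus R r)) ≤
      ENNReal.ofReal (Real.sqrt (π / 2) * (1 + Real.sqrt (Real.log (R / r))) * R ^ 2) *
        eLpNorm (fun y => fderiv ℝ ζ y) 2 (volume.restrict (annulus R r)) := by
  obtain ⟨hr0, hrR⟩ := hr
  have hζ1 : ContDiffOn ℝ 1 ζ (annulus R r) := hζ.of_le (by simp)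
  have hdc : ContinuousOn (fderiv ℝ ζ) (annulus R r) :=
    hζ1.continuousOn_fderiv_of_isOpen (isOpen_annulus R r) le_rfl
  have hdc2 : ContinuousOn (fun y => ‖fderiv ℝ ζ y‖ₑ ^ 2) (annulus R r) :=
    (ENNReal.continuous_pow 2).comp_continuousOn hdc.enorm
  have h := lintegral_polar_poincare hr0 hrR (F := fun s θ => ζ (polarMap s θ))
    (G := fun s θ => ‖fderiv ℝ ζ (polarMap s θ)‖ₑ)
    (aestronglyMeasurable_comp_polarMap hr0 hdc).enorm
    (fun s hs => continuous_comp_polarMap hr0 hζ.continuousOn hs)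
    (integrable_smul_comp_polarMap hr0 hζ.continuousOn hζint)
    (by rw [← integral_annulus hr0, hint])
    (fun s hs => lintegral_circle_sub_average_sq_le hr0 hζ1 hs)
    (fun t ht s hs hts θ => enorm_polarMap_sub_polarMap_le hr0 hζ1 ht hs hts θ)
  rw [eLpNorm_one_eq_lintegral_enorm, eLpNorm_eq_lintegral_rpow_enorm_toReal (by simp) (by simp)]
  simp only [ENNReal.toReal_ofNat, ENNReal.rpow_ofNat]
  rw [lintegral_annulus_of_continuousOn hr0 hζ.continuousOn.enorm,
    lintegral_annulus_of_continuousOn hr0 hdc2]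
  exact h
end

section
/- Let k ≥ 1, let 𝒟 ⊂ ℝ² be a bounded open convex domain, let ξ : 𝒟 → ℝ^k be a smooth integrable function, and let x ∈ 𝒟. Then |ξ_𝒟 − ξ(x)| ≤ (2 r₀² / |𝒟|) · ∫_𝒟 |d_y ξ| · |y − x|^{−1} dy, where 2 r₀ is the diameter of 𝒟, |𝒟| is the Lebesgue measure (area) of 𝒟, and ξ_𝒟 = (1/|𝒟|) ∫_𝒟 ξ(y) dy is the average value of ξ on 𝒟 (the inequality is understood to hold with the convention that the right-hand side may be +∞). -/
open MeasureTheory Real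

/-- Change of variables in a Lebesgue integral on the plane under the homothety of centre `x` and
ratio `t`. -/
theorem lintegral_comp_homothety_plane (x : EuclideanSpace ℝ (Fin 2))
    {H : EuclideanSpace ℝ (Fin 2) → ENNReal} (hH : Measurable H) {t : ℝ} (ht : 0 < t) :
    ∫⁻ y, H (x + t • (y - x)) = ENNReal.ofReal (t ^ 2)⁻¹ * ∫⁻ z, H z := by
  have h1 : ∫⁻ y, H (x + t • (y - x)) = ∫⁻ y, H (x + t • y) :=
    lintegral_sub_right_eq_self (fun y => H (x + t • y)) x
  have h2 : ∫⁻ z, H (x + z) = ∫⁻ z, H z := lintegral_add_left_eq_self H x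
  have hm : Measurable fun z => H (x + z) := hH.comp (measurable_const_add x)
  rw [h1, ← h2, ← lintegral_map hm (measurable_const_smul t),
    Measure.map_addHaar_smul _ ht.ne', lintegral_smul_measure]
  simp [abs_of_pos ht]

/-- The increment of a `C¹` function on a convex open set is bounded by the integral of the norm of
its derivative along a segment. -/
theorem enorm_sub_le_lintegral_fderiv_segment {E F : Type*} [NormedAddCommGroup E]
    [NormedSpace ℝ E] [NormedAddCommGroup F] [NormedSpace ℝ F] [CompleteSpace F]
    {D : Set E} (hDo : IsOpen D) (hDc : Convex ℝ D) {ξ : E → F} (hξ : ContDiffOn ℝ 1 ξ D)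
    {x y : E} (hx : x ∈ D) (hy : y ∈ D) :
    ‖ξ y - ξ x‖ₑ ≤ ∫⁻ t in Set.Ioc (0 : ℝ) 1, ‖fderiv ℝ ξ (x + t • (y - x))‖ₑ * ‖y - x‖ₑ := by
  have hmem : ∀ t ∈ Set.uIcc (0 : ℝ) 1, x + t • (y - x) ∈ D := fun t ht => by
    rw [Set.uIcc_of_le zero_le_one] at ht
    exact hDc.add_smul_sub_mem hx hy ht
  have hderiv : ∀ t ∈ Set.uIcc (0 : ℝ) 1,
      HasDerivAt (fun s : ℝ => ξ (x + s • (y - x))) (fderiv ℝ ξ (x + t • (y - x)) (y - x)) t := by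
    intro t ht
    have h1 : HasFDerivAt ξ (fderiv ℝ ξ (x + t • (y - x))) (x + t • (y - x)) :=
      ((hξ.differentiableOn one_ne_zero).differentiableAt
        (hDo.mem_nhds (hmem t ht))).hasFDerivAt
    have h2 : HasDerivAt (fun s : ℝ => x + s • (y - x)) (y - x) t := by
      simpa using ((hasDerivAt_id t).smul_const (y - x)).const_add x
    exact h1.comp_hasDerivAt t h2
  have hcont : ContinuousOn (fun t : ℝ => fderiv ℝ ξ (x + t • (y - x)) (y - x))
      (Set.uIcc (0 : ℝ) 1) := by
    have h := (hξ.continuousOn_fderiv_of_isOpen hDo le_rfl).comp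
      (f := fun t : ℝ => x + t • (y - x)) (by fun_prop) hmem
    exact h.clm_apply continuousOn_const
  have hftc := intervalIntegral.integral_eq_sub_of_hasDerivAt hderiv hcont.intervalIntegrable
  simp only [one_smul, zero_smul, add_zero, add_sub_cancel] at hftc
  rw [← hftc, intervalIntegral.integral_of_le zero_le_one]
  exact (enorm_integral_le_lintegral_enorm _).trans
    (lintegral_mono fun t => ContinuousLinearMap.le_opENorm _ _)

theorem lintegral_Ici_inv_cube {a : ℝ} (ha : 0 < a) :
    ∫⁻ t in Set.Ici a, ENNReal.ofReal (t ^ 3)⁻¹ = ENNReal.ofReal ((a ^ 2)⁻¹ / 2) := by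
  have hrpow : ∀ t ∈ Set.Ioi a, t ^ (-3 : ℝ) = (t ^ 3)⁻¹ := fun t ht => by
    rw [rpow_neg (ha.trans ht).le]
    norm_cast
  have hint : IntegrableOn (fun t : ℝ => (t ^ 3)⁻¹) (Set.Ioi a) :=
    (integrableOn_Ioi_rpow_of_lt (by norm_num) ha).congr_fun hrpow measurableSet_Ioi
  rw [setLIntegral_congr Ioi_ae_eq_Ici.symm, ← ofReal_integral_eq_lintegral_ofReal hint
    ((ae_restrict_mem measurableSet_Ioi).mono fun t ht => by
      have := ha.trans ht
      positivity),
    ← setIntegral_congr_fun measurableSet_Ioi hrpow,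
    integral_Ioi_rpow_of_lt (by norm_num) ha]
  congr 1
  have : a ^ (-3 + 1 : ℝ) = (a ^ 2)⁻¹ := by
    norm_num
  rw [this]
  ring

/-- Integrating `g` over all segments from `x` to a point of a bounded convex plane set produces the
Riesz potential of `g` at `x`. -/
theorem lintegral_lintegral_segment_le {D : Set (EuclideanSpace ℝ (Fin 2))}
    (hDm : MeasurableSet D) (hDc : Convex ℝ D) (hDb : Bornology.IsBounded D)
    {g : EuclideanSpace ℝ (Fin 2) → ENNReal} (hg : Measurable g)
    {x : EuclideanSpace ℝ (Fin 2)} (hx : x ∈ D) :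
    ∫⁻ y in D, ∫⁻ t in Set.Ioc (0 : ℝ) 1, g (x + t • (y - x)) * ‖y - x‖ₑ ≤
      ENNReal.ofReal (Metric.diam D ^ 2 / 2) *
        ∫⁻ z in D, g z * ENNReal.ofReal ‖z - x‖⁻¹ := by
  set d := Metric.diam D with hd
  let H : ℝ → EuclideanSpace ℝ (Fin 2) → ENNReal := fun t z =>
    D.indicator 1 z * (Set.Ici (0 : ℝ)).indicator 1 (d * t - ‖z - x‖) *
      (g z * ENNReal.ofReal (‖z - x‖ / t))
  have hH : Measurable (Function.uncurry H) := by
    have h1 : Measurable (D.indicator (1 : EuclideanSpace ℝ (Fin 2) → ENNReal)) :=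
      measurable_one.indicator hDm
    have h2 : Measurable ((Set.Ici (0 : ℝ)).indicator (1 : ℝ → ENNReal)) :=
      measurable_one.indicator measurableSet_Ici
    unfold Function.uncurry
    fun_prop
  have hle : ∀ t ∈ Set.Ioc (0 : ℝ) 1, ∀ y ∈ D,
      g (x + t • (y - x)) * ‖y - x‖ₑ ≤ H t (x + t • (y - x)) := by
    intro t ht y hy
    have hz : x + t • (y - x) ∈ D := hDc.add_smul_sub_mem hx hy ⟨ht.1.le, ht.2⟩
    have hn : ‖x + t • (y - x) - x‖ = t * ‖y - x‖ := by
      rw [add_sub_cancel_left, norm_smul, norm_of_nonneg ht.1.le]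
    have hdist : ‖y - x‖ ≤ d := by
      rw [← dist_eq_norm]
      exact Metric.dist_le_diam_of_mem hDb hy hx
    have hI : d * t - t * ‖y - x‖ ∈ Set.Ici (0 : ℝ) := by
      rw [Set.mem_Ici]
      nlinarith [ht.1]
    simp only [H, hn, Set.indicator_of_mem hz, Set.indicator_of_mem hI, Pi.one_apply, one_mul]
    rw [mul_div_cancel_left₀ _ ht.1.ne', ofReal_norm]
  have hinner : ∀ z, ∫⁻ t in Set.Ioc (0 : ℝ) 1, ENNReal.ofReal (t ^ 2)⁻¹ * H t z ≤
      D.indicator (fun z => ENNReal.ofReal (d ^ 2 / 2) *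
        (g z * ENNReal.ofReal ‖z - x‖⁻¹)) z := by
    intro z
    by_cases hz : z ∈ D
    swap
    · simp [H, hz]
    rw [Set.indicator_of_mem hz]
    rcases eq_or_ne z x with rfl | hzx
    · simp [H]
    have hr : 0 < ‖z - x‖ := norm_pos_iff.2 (sub_ne_zero.2 hzx)
    have hdpos : 0 < d := hr.trans_le <| by
      rw [← dist_eq_norm]
      exact Metric.dist_le_diam_of_mem hDb hz hx
    have hpt : ∀ t ∈ Set.Ioc (0 : ℝ) 1, ENNReal.ofReal (t ^ 2)⁻¹ * H t z ≤
        g z * ENNReal.ofReal ‖z - x‖ *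
          (Set.Ici (‖z - x‖ / d)).indicator (fun t => ENNReal.ofReal (t ^ 3)⁻¹) t := by
      intro t ht
      by_cases hI : d * t - ‖z - x‖ ∈ Set.Ici (0 : ℝ)
      swap
      · simp only [H, Set.indicator_of_notMem hI, mul_zero, zero_mul, zero_le]
      have hI' : t ∈ Set.Ici (‖z - x‖ / d) := by
        rw [Set.mem_Ici, div_le_iff₀ hdpos]
        rw [Set.mem_Ici] at hI
        linarith
      simp only [H, Set.indicator_of_mem hz, Set.indicator_of_mem hI, Set.indicator_of_mem hI',
        Pi.one_apply, one_mul]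
      rw [mul_left_comm, mul_assoc, ← ENNReal.ofReal_mul (inv_nonneg.2 (sq_nonneg t)),
        ← ENNReal.ofReal_mul hr.le]
      apply le_of_eq
      congr 2
      have := ht.1.ne'
      field_simp
    calc _ ≤ ∫⁻ t in Set.Ioc (0 : ℝ) 1, g z * ENNReal.ofReal ‖z - x‖ *
          (Set.Ici (‖z - x‖ / d)).indicator (fun t => ENNReal.ofReal (t ^ 3)⁻¹) t :=
        setLIntegral_mono' measurableSet_Ioc hpt
      _ ≤ ∫⁻ t, g z * ENNReal.ofReal ‖z - x‖ *
          (Set.Ici (‖z - x‖ / d)).indicator (fun t => ENNReal.ofReal (t ^ 3)⁻¹) t :=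
        setLIntegral_le_lintegral _ _
      _ = g z * ENNReal.ofReal ‖z - x‖ * ENNReal.ofReal (((‖z - x‖ / d) ^ 2)⁻¹ / 2) := by
        rw [lintegral_const_mul _ ((by fun_prop : Measurable fun t : ℝ =>
            ENNReal.ofReal (t ^ 3)⁻¹).indicator measurableSet_Ici),
          lintegral_indicator measurableSet_Ici, lintegral_Ici_inv_cube (by positivity)]
      _ = _ := by
        rw [mul_left_comm, mul_assoc, ← ENNReal.ofReal_mul hr.le,
          ← ENNReal.ofReal_mul (by positivity)]
        congr 2
        field_simp
  calc _ ≤ ∫⁻ y in D, ∫⁻ t in Set.Ioc (0 : ℝ) 1, H t (x + t • (y - x)) :=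
        setLIntegral_mono' hDm fun y hy =>
          setLIntegral_mono' measurableSet_Ioc fun t ht => hle t ht y hy
    _ ≤ ∫⁻ y, ∫⁻ t in Set.Ioc (0 : ℝ) 1, H t (x + t • (y - x)) :=
        setLIntegral_le_lintegral _ _
    _ = ∫⁻ t in Set.Ioc (0 : ℝ) 1, ∫⁻ y, H t (x + t • (y - x)) := by
        refine lintegral_lintegral_swap (Measurable.aemeasurable ?_)
        exact hH.comp (f := fun p : EuclideanSpace ℝ (Fin 2) × ℝ =>
          (p.2, x + p.2 • (p.1 - x))) (by fun_prop)
    _ = ∫⁻ t in Set.Ioc (0 : ℝ) 1, ∫⁻ z, ENNReal.ofReal (t ^ 2)⁻¹ * H t z := by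
        refine setLIntegral_congr_fun measurableSet_Ioc fun t ht => ?_
        have hHt : Measurable (H t) := hH.of_uncurry_left
        simp only [lintegral_const_mul _ hHt]
        exact lintegral_comp_homothety_plane x hHt ht.1
    _ = ∫⁻ z, ∫⁻ t in Set.Ioc (0 : ℝ) 1, ENNReal.ofReal (t ^ 2)⁻¹ * H t z := by
        refine lintegral_lintegral_swap (Measurable.aemeasurable ?_)
        exact (by fun_prop : Measurable fun p : ℝ × EuclideanSpace ℝ (Fin 2) =>
          ENNReal.ofReal (p.1 ^ 2)⁻¹).mul hH
    _ ≤ _ := lintegral_mono hinner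
    _ = _ := by
        rw [lintegral_indicator hDm, lintegral_const_mul _ (by fun_prop)]

/-- **Mean-value estimate on a bounded convex domain.**
For a bounded open convex `𝒟 ⊂ ℝ²`, a smooth integrable `ξ : 𝒟 → ℝ^k`, and `x ∈ 𝒟`:
`|ξ_𝒟 − ξ(x)| ≤ (2 r₀² / |𝒟|) ∫_𝒟 |d_y ξ| |y − x|⁻¹ dy`, where `2 r₀ = diam 𝒟` and
`ξ_𝒟` is the average of `ξ` over `𝒟`; the right-hand side may be `+∞`. -/
theorem stmt2 (k : ℕ) (hk : 1 ≤ k) (D : Set (EuclideanSpace ℝ (Fin 2)))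
    (hDo : IsOpen D) (hDc : Convex ℝ D) (hDb : Bornology.IsBounded D)
    (ξ : EuclideanSpace ℝ (Fin 2) → EuclideanSpace ℝ (Fin k))
    (hξ : ContDiffOn ℝ (⊤ : ℕ∞) ξ D) (hξint : IntegrableOn ξ D)
    (x : EuclideanSpace ℝ (Fin 2)) (hx : x ∈ D) :
    ENNReal.ofReal ‖(volume D).toReal⁻¹ • (∫ y in D, ξ y) - ξ x‖ ≤
      ENNReal.ofReal (2 * (Metric.diam D / 2) ^ 2 / (volume D).toReal) *
        ∫⁻ y in D, ENNReal.ofReal (‖fderiv ℝ ξ y‖ * ‖y - x‖⁻¹) := by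
  have hpos : 0 < (volume D).toReal :=
    ENNReal.toReal_pos (hDo.measure_pos volume ⟨x, hx⟩).ne' hDb.measure_lt_top.ne
  have hmean : (volume D).toReal⁻¹ • (∫ y in D, ξ y) - ξ x =
      (volume D).toReal⁻¹ • ∫ y in D, (ξ y - ξ x) := by
    rw [integral_sub hξint (integrableOn_const hDb.measure_lt_top.ne), setIntegral_const,
      smul_sub, Measure.real, inv_smul_smul₀ hpos.ne']
  have hg : Measurable fun y => ‖fderiv ℝ ξ y‖ₑ := (measurable_fderiv ℝ ξ).enorm
  have hseg : ∫⁻ y in D, ‖ξ y - ξ x‖ₑ ≤ ENNReal.ofReal (Metric.diam D ^ 2 / 2) *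
      ∫⁻ y in D, ‖fderiv ℝ ξ y‖ₑ * ENNReal.ofReal ‖y - x‖⁻¹ :=
    (setLIntegral_mono' hDo.measurableSet fun y hy =>
      enorm_sub_le_lintegral_fderiv_segment hDo hDc (hξ.of_le (by exact_mod_cast le_top))
        hx hy).trans
      (lintegral_lintegral_segment_le hDo.measurableSet hDc hDb hg hx)
  rw [hmean, ofReal_norm, enorm_smul, enorm_of_nonneg (inv_nonneg.2 hpos.le)]
  calc _ ≤ ENNReal.ofReal (volume D).toReal⁻¹ * (ENNReal.ofReal (Metric.diam D ^ 2 / 2) *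
        ∫⁻ y in D, ‖fderiv ℝ ξ y‖ₑ * ENNReal.ofReal ‖y - x‖⁻¹) := by
        gcongr
        exact (enorm_integral_le_lintegral_enorm _).trans hseg
    _ = _ := by
        rw [← mul_assoc, ← ENNReal.ofReal_mul (inv_nonneg.2 hpos.le)]
        simp only [ENNReal.ofReal_mul (norm_nonneg _), ofReal_norm]
        congr 2
        ring
end

section
/- Let p, q ≥ 1 satisfy 1 − 2/p = −2/q. For all R > 0, r ∈ [0, R), and every smooth function ξ : B_{R,r} → ℝ^k such that the closure in ℝ² of the support {z ∈ B_{R,r} : ξ(z) ≠ 0} is contained in B_R \ B_r, one has ‖ξ‖_q ≤ q · ‖dξ‖_p. -/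
open MeasureTheory Real

section RaySobolev

open Set
open scoped ENNReal

/-- Inequality along a ray on which the distance to the origin increases. -/
lemma enorm_le_lintegral_fderiv_ray {E F : Type*} [NormedAddCommGroup E] [InnerProductSpace ℝ E]
    [NormedAddCommGroup F] [NormedSpace ℝ F] {w : E → F} {ρ R : ℝ}
    (hw : ContDiffOn ℝ 1 w {z | ρ < ‖z‖}) (hwR : ∀ z, R ≤ ‖z‖ → w z = 0)
    {x v : E} (hx : ρ < ‖x‖) (hv : ‖v‖ = 1) (hxv : 0 ≤ inner ℝ x v) :
    ‖w x‖ₑ ≤ ∫⁻ t : ℝ, {z | ρ < ‖z‖}.indicator (fun z => ‖fderiv ℝ w z‖ₑ) (x + t • v) := by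
  have hU : IsOpen {z : E | ρ < ‖z‖} := isOpen_lt continuous_const continuous_norm
  have hnorm : ∀ t : ℝ, 0 ≤ t → ‖x + t • v‖ ^ 2 = ‖x‖ ^ 2 + 2 * (t * inner ℝ x v) + t ^ 2 := by
    intro t ht
    rw [norm_add_sq_real, inner_smul_right, norm_smul, hv, mul_one, Real.norm_eq_abs, sq_abs]
  have hmem : ∀ t : ℝ, 0 ≤ t → ρ < ‖x + t • v‖ := by
    intro t ht
    refine hx.trans_le (le_of_sq_le_sq ?_ (norm_nonneg _))
    nlinarith [hnorm t ht, mul_nonneg ht hxv, sq_nonneg t]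
  have hfar : w (x + |R| • v) = 0 := by
    refine hwR _ ((le_abs_self R).trans (le_of_sq_le_sq ?_ (norm_nonneg _)))
    nlinarith [hnorm |R| (abs_nonneg R), mul_nonneg (abs_nonneg R) hxv, sq_nonneg ‖x‖]
  have hline : ContDiff ℝ 1 (fun t : ℝ => x + t • v) := by fun_prop
  have hcomp : ContDiffOn ℝ 1 (fun t : ℝ => w (x + t • v)) (Icc 0 |R|) :=
    hw.comp hline.contDiffOn fun t ht => hmem t ht.1
  have key := enorm_sub_le_lintegral_deriv_of_contDiffOn_Icc hcomp (abs_nonneg R)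
  simp only [hfar, zero_smul, add_zero, zero_sub, enorm_neg] at key
  refine key.trans (le_trans ?_ (setLIntegral_le_lintegral (Icc 0 |R|) _))
  refine setLIntegral_mono' measurableSet_Icc fun t ht => ?_
  rw [indicator_of_mem (show x + t • v ∈ {z | ρ < ‖z‖} from hmem t ht.1)]
  have hd : HasDerivAt (fun t : ℝ => x + t • v) v t := by
    simpa using ((hasDerivAt_id t).smul_const v).const_add x
  have hdw : DifferentiableAt ℝ w (x + t • v) :=
    (hw.contDiffAt (hU.mem_nhds (hmem t ht.1))).differentiableAt one_ne_zero
  have := hdw.hasFDerivAt.comp_hasDerivAt t hd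
  rw [show deriv (fun t : ℝ => w (x + t • v)) t = fderiv ℝ w (x + t • v) v from this.deriv]
  rw [← ofReal_norm, ← ofReal_norm]
  refine ENNReal.ofReal_le_ofReal ?_
  simpa [hv] using (fderiv ℝ w (x + t • v)).le_opNorm v

lemma enorm_le_lintegral_fderiv_line {E F : Type*} [NormedAddCommGroup E] [InnerProductSpace ℝ E]
    [NormedAddCommGroup F] [NormedSpace ℝ F] {w : E → F} {ρ R : ℝ}
    (hw : ContDiffOn ℝ 1 w {z | ρ < ‖z‖}) (hwR : ∀ z, R ≤ ‖z‖ → w z = 0)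
    {x v : E} (hx : ρ < ‖x‖) (hv : ‖v‖ = 1) :
    ‖w x‖ₑ ≤ ∫⁻ t : ℝ, {z | ρ < ‖z‖}.indicator (fun z => ‖fderiv ℝ w z‖ₑ) (x + t • v) := by
  rcases le_total 0 (inner ℝ x v) with h | h
  · exact enorm_le_lintegral_fderiv_ray hw hwR hx hv h
  · have := enorm_le_lintegral_fderiv_ray hw hwR hx (v := -v) (by rwa [norm_neg])
      (by rw [inner_neg_right]; linarith)
    rw [← lintegral_neg_eq_self]
    simpa using this

lemma volume_preserving_euclideanPlane :
    MeasurePreserving (fun z : ℝ × ℝ => (!₂[z.1, z.2] : EuclideanSpace ℝ (Fin 2))) :=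
  (PiLp.volume_preserving_toLp (Fin 2)).comp (volume_preserving_finTwoArrow ℝ).symm

/-- The `L²`-`L¹` Sobolev inequality outside a disk, for functions of bounded support. -/
lemma lintegral_enorm_sq_le_lintegral_fderiv_sq {F : Type*} [NormedAddCommGroup F]
    [NormedSpace ℝ F] [CompleteSpace F] {w : EuclideanSpace ℝ (Fin 2) → F} {ρ R : ℝ}
    (hw : ContDiffOn ℝ 1 w {z | ρ < ‖z‖}) (hwR : ∀ z, R ≤ ‖z‖ → w z = 0) :
    ∫⁻ z in {z | ρ < ‖z‖}, ‖w z‖ₑ ^ (2 : ℝ) ≤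
      (∫⁻ z in {z | ρ < ‖z‖}, ‖fderiv ℝ w z‖ₑ) ^ (2 : ℝ) := by
  set U : Set (EuclideanSpace ℝ (Fin 2)) := {z | ρ < ‖z‖}
  have hUm : MeasurableSet U := (isOpen_lt continuous_const continuous_norm).measurableSet
  set g : EuclideanSpace ℝ (Fin 2) → ℝ≥0∞ := U.indicator (fun z => ‖fderiv ℝ w z‖ₑ)
  have hgm : Measurable g := (measurable_fderiv ℝ w).enorm.indicator hUm
  set e : ℝ × ℝ → EuclideanSpace ℝ (Fin 2) := fun z => !₂[z.1, z.2] with he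
  have hem : MeasurePreserving e := volume_preserving_euclideanPlane
  have hge : Measurable (fun z : ℝ × ℝ => g (e z)) := hgm.comp hem.measurable
  set G : ℝ → ℝ≥0∞ := fun a => ∫⁻ b, g (e (a, b))
  set H : ℝ → ℝ≥0∞ := fun b => ∫⁻ a, g (e (a, b))
  have hGm : Measurable G := hge.lintegral_prod_right'
  have hHm : Measurable H := hge.lintegral_prod_left'
  have hGint : ∫⁻ a, G a = ∫⁻ z, g z := by
    rw [← hem.lintegral_comp hgm, Measure.volume_eq_prod, lintegral_prod _ hge.aemeasurable]
  have hHint : ∫⁻ b, H b = ∫⁻ z, g z := by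
    rw [← hem.lintegral_comp hgm, Measure.volume_eq_prod, lintegral_prod_symm _ hge.aemeasurable]
  have hfst : ∀ a b : ℝ, e (a, b) ∈ U → ‖w (e (a, b))‖ₑ ≤ H b := by
    intro a b hab
    have := enorm_le_lintegral_fderiv_line hw hwR (x := e (a, b)) (v := e (1, 0)) hab
      (by simp [he, EuclideanSpace.norm_eq])
    refine this.trans_eq (Eq.trans ?_ (lintegral_add_left_eq_self (fun s => g (e (s, b))) a))
    refine lintegral_congr fun t => ?_
    change g (e (a, b) + t • e (1, 0)) = g (e (a + t, b))
    congr 1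
    ext i
    fin_cases i <;> simp [he]
  have hsnd : ∀ a b : ℝ, e (a, b) ∈ U → ‖w (e (a, b))‖ₑ ≤ G a := by
    intro a b hab
    have := enorm_le_lintegral_fderiv_line hw hwR (x := e (a, b)) (v := e (0, 1)) hab
      (by simp [he, EuclideanSpace.norm_eq])
    refine this.trans_eq (Eq.trans ?_ (lintegral_add_left_eq_self (fun s => g (e (a, s))) b))
    refine lintegral_congr fun t => ?_
    change g (e (a, b) + t • e (0, 1)) = g (e (a, b + t))
    congr 1
    ext i
    fin_cases i <;> simp [he]
  have hpt : ∀ z : ℝ × ℝ, U.indicator (fun z => ‖w z‖ₑ ^ (2 : ℝ)) (e z) ≤ G z.1 * H z.2 := by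
    rintro ⟨a, b⟩
    by_cases hab : e (a, b) ∈ U
    · rw [indicator_of_mem hab, ENNReal.rpow_two, sq]
      exact mul_le_mul' (hsnd a b hab) (hfst a b hab)
    · simp [indicator_of_notMem hab]
  have hwm : Measurable (U.indicator fun z => ‖w z‖ₑ ^ (2 : ℝ)) := by
    classical
    rw [← Set.piecewise_eq_indicator]
    refine ContinuousOn.measurable_piecewise ?_ continuousOn_const hUm
    exact (ENNReal.continuous_rpow_const.comp_continuousOn hw.continuousOn.enorm)
  rw [← lintegral_indicator hUm, ← lintegral_indicator hUm, ← hem.lintegral_comp hwm]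
  refine (lintegral_mono hpt).trans ?_
  rw [Measure.volume_eq_prod, lintegral_prod_mul hGm.aemeasurable hHm.aemeasurable, hGint, hHint,
    ENNReal.rpow_two, sq]

lemma enorm_fderiv_norm_rpow_le_of_differentiableAt {E F : Type*} [NormedAddCommGroup E]
    [NormedSpace ℝ E] [NormedAddCommGroup F] [InnerProductSpace ℝ F] {u : E → F} {x : E}
    (hu : DifferentiableAt ℝ u x) {γ : ℝ} (hγ : 1 < γ) :
    ‖fderiv ℝ (fun z => ‖u z‖ ^ γ) x‖ₑ ≤
      ENNReal.ofReal γ * (‖u x‖ₑ ^ (γ - 1) * ‖fderiv ℝ u x‖ₑ) := by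
  have h := ((hasFDerivAt_norm_rpow (u x) hγ).comp x hu.hasFDerivAt).fderiv
  rw [show fderiv ℝ (fun z => ‖u z‖ ^ γ) x = _ from h, ← ofReal_norm, ← ofReal_norm, ← ofReal_norm,
    ENNReal.ofReal_rpow_of_nonneg (norm_nonneg _) (by linarith),
    ← ENNReal.ofReal_mul (by positivity), ← ENNReal.ofReal_mul (by positivity)]
  refine ENNReal.ofReal_le_ofReal ?_
  have hn : ‖(γ * ‖u x‖ ^ (γ - 2)) • innerSL ℝ (u x)‖ = γ * ‖u x‖ ^ (γ - 1) := by
    rw [← fderiv_norm_rpow (u x) hγ, norm_fderiv_norm_id_rpow (u x) hγ]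
  refine (ContinuousLinearMap.opNorm_comp_le _ _).trans_eq ?_
  rw [hn, mul_assoc]

/-- The Sobolev inequality outside a disk, for functions of bounded support and finite norm. -/
lemma lintegral_rpow_le_of_lintegral_rpow_ne_top {F : Type*} [NormedAddCommGroup F]
    [InnerProductSpace ℝ F] [CompleteSpace F] {p q : ℝ} (hp : 1 ≤ p) (hq : 1 ≤ q)
    (hpq : 1 - 2 / p = -(2 / q)) {u : EuclideanSpace ℝ (Fin 2) → F} {ρ R : ℝ}
    (hu : ContDiffOn ℝ 1 u {z | ρ < ‖z‖}) (huR : ∀ z, R ≤ ‖z‖ → u z = 0)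
    (hfin : ∫⁻ z in {z | ρ < ‖z‖}, ‖u z‖ₑ ^ q ≠ ⊤) :
    (∫⁻ z in {z | ρ < ‖z‖}, ‖u z‖ₑ ^ q) ^ (1 / q) ≤
      ENNReal.ofReal (q / 2) * (∫⁻ z in {z | ρ < ‖z‖}, ‖fderiv ℝ u z‖ₑ ^ p) ^ (1 / p) := by
  have hU : IsOpen {z : EuclideanSpace ℝ (Fin 2) | ρ < ‖z‖} :=
    isOpen_lt continuous_const continuous_norm
  have hp0 : 0 < p := by linarith
  have hq0 : 0 < q := by linarith
  have hinv : 1 / p = 1 / 2 + 1 / q := by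
    have h1 : 2 / p = 2 * (1 / p) := by ring
    have h2 : 2 / q = 2 * (1 / q) := by ring
    linarith
  rcases hp.eq_or_lt with rfl | hp1
  · have hq2 : q = 2 := by
      have : 1 / q = 1 / 2 := by linarith
      field_simp at this
      linarith
    subst hq2
    have := ENNReal.rpow_le_rpow (lintegral_enorm_sq_le_lintegral_fderiv_sq hu huR)
      (by norm_num : (0 : ℝ) ≤ 1 / 2)
    rw [← ENNReal.rpow_mul] at this
    simpa using this
  have hq2 : 2 < q := by
    have h1 : 1 / p < 1 := by rw [div_lt_one hp0]; exact hp1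
    have h2 : 1 / q < 1 / 2 := by linarith
    exact (one_div_lt_one_div hq0 two_pos).1 h2
  set A := ∫⁻ z in {z | ρ < ‖z‖}, ‖u z‖ₑ ^ q
  set D := ∫⁻ z in {z | ρ < ‖z‖}, ‖fderiv ℝ u z‖ₑ ^ p
  rcases eq_or_ne A 0 with hA0 | hA0
  · simp [hA0, hq0]
  set γ := q / 2 with hγ
  have hγ1 : 1 < γ := by rw [hγ]; linarith
  set p' := p / (p - 1) with hp'
  have hconj : p'.HolderConjugate p := (Real.HolderConjugate.conjExponent hp1).symm
  have hp'inv : 1 / p' = 1 - 1 / p := by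
    rw [hp']; field_simp
  have hp'q : (γ - 1) * p' = q := by
    have h0 : 0 < p' := hconj.pos
    have h3 : 1 / p' = (γ - 1) / q := by
      rw [hp'inv, hinv, hγ]; field_simp; ring
    rw [div_eq_div_iff h0.ne' hq0.ne'] at h3
    linarith
  have hum : AEMeasurable (fun z => ‖u z‖ₑ ^ (γ - 1)) (volume.restrict {z | ρ < ‖z‖}) :=
    (ENNReal.continuous_rpow_const.comp_continuousOn hu.continuousOn.enorm).aemeasurable
      hU.measurableSet
  have hdm : Measurable (fun z => ‖fderiv ℝ u z‖ₑ) := (measurable_fderiv ℝ u).enorm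
  have hw : ContDiffOn ℝ 1 (fun z => ‖u z‖ ^ γ) {z | ρ < ‖z‖} :=
    (contDiff_norm_rpow hγ1).comp_contDiffOn hu
  have hbase := lintegral_enorm_sq_le_lintegral_fderiv_sq (R := R) hw fun z hz => by
    simp [huR z hz, show γ ≠ 0 by linarith]
  have hleft : ∫⁻ z in {z | ρ < ‖z‖}, ‖‖u z‖ ^ γ‖ₑ ^ (2 : ℝ) = A := by
    refine lintegral_congr fun z => ?_
    rw [Real.enorm_rpow_of_nonneg (norm_nonneg _) (by linarith), ← ENNReal.rpow_mul, enorm_norm]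
    congr 1
    rw [hγ]; ring
  have hright : ∫⁻ z in {z | ρ < ‖z‖}, ‖fderiv ℝ (fun z => ‖u z‖ ^ γ) z‖ₑ ≤
      ENNReal.ofReal γ * (A ^ (1 / p') * D ^ (1 / p)) := by
    calc _ ≤ ∫⁻ z in {z | ρ < ‖z‖}, ENNReal.ofReal γ * (‖u z‖ₑ ^ (γ - 1) * ‖fderiv ℝ u z‖ₑ) :=
          setLIntegral_mono' hU.measurableSet fun z hz =>
            enorm_fderiv_norm_rpow_le_of_differentiableAt
              ((hu.contDiffAt (hU.mem_nhds hz)).differentiableAt one_ne_zero) hγ1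
      _ = ENNReal.ofReal γ * ∫⁻ z in {z | ρ < ‖z‖}, ‖u z‖ₑ ^ (γ - 1) * ‖fderiv ℝ u z‖ₑ :=
          lintegral_const_mul' _ _ ENNReal.ofReal_ne_top
      _ ≤ _ := by
          gcongr
          have := ENNReal.lintegral_mul_le_Lp_mul_Lq _ hconj hum hdm.aemeasurable
          simpa only [Pi.mul_apply, ← ENNReal.rpow_mul, hp'q] using this
  rw [hleft] at hbase
  have hsqrt : A ^ (1 / 2 : ℝ) ≤ ENNReal.ofReal γ * (A ^ (1 / p') * D ^ (1 / p)) := by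
    refine (ENNReal.rpow_le_rpow hbase (by norm_num)).trans ?_
    rw [← ENNReal.rpow_mul]
    simpa using hright
  have hsplit : A ^ (1 / 2 : ℝ) = A ^ (1 / p') * A ^ (1 / q) := by
    rw [← ENNReal.rpow_add _ _ hA0 hfin]
    congr 1
    linarith
  rw [hsplit, mul_left_comm] at hsqrt
  exact (ENNReal.mul_le_mul_iff_right (ENNReal.rpow_pos (pos_iff_ne_zero.2 hA0) hfin).ne'
    (ENNReal.rpow_ne_top_of_nonneg (by rw [hp'inv, hinv]; linarith [hinv, (div_lt_one hp0).2 hp1])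
      hfin)).1 hsqrt

lemma setLIntegral_enorm_rpow_ne_top {F : Type*} [NormedAddCommGroup F] {q : ℝ} (hq : 0 < q)
    {u : EuclideanSpace ℝ (Fin 2) → F} {r ρ R : ℝ} (hρ : r < ρ)
    (hu : ContinuousOn u {z | r < ‖z‖}) (huR : ∀ z, R ≤ ‖z‖ → u z = 0) :
    ∫⁻ z in {z | ρ < ‖z‖}, ‖u z‖ₑ ^ q ≠ ⊤ := by
  have hK : IsCompact (Metric.closedBall (0 : EuclideanSpace ℝ (Fin 2)) R \ Metric.ball 0 ρ) :=
    (isCompact_closedBall 0 R).diff Metric.isOpen_ball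
  obtain ⟨C, hC⟩ := hK.exists_bound_of_continuousOn (hu.mono fun z hz => by
    have := hz.2
    simp only [mem_ball_zero_iff, not_lt] at this
    exact hρ.trans_le this)
  have hm : MeasurableSet {z : EuclideanSpace ℝ (Fin 2) | ρ < ‖z‖} :=
    (isOpen_lt continuous_const continuous_norm).measurableSet
  have hle : ∫⁻ z in {z | ρ < ‖z‖}, ‖u z‖ₑ ^ q ≤
      ∫⁻ z, (Metric.closedBall (0 : EuclideanSpace ℝ (Fin 2)) R).indicator
        (fun _ => ENNReal.ofReal C ^ q) z := by
    refine (setLIntegral_mono' hm fun z hz => ?_).trans (setLIntegral_le_lintegral _ _)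
    by_cases hzR : ‖z‖ ≤ R
    · rw [indicator_of_mem (by simpa using hzR)]
      refine ENNReal.rpow_le_rpow ?_ hq.le
      rw [← ofReal_norm]
      refine ENNReal.ofReal_le_ofReal (hC z ⟨by simpa using hzR, ?_⟩)
      simpa using (le_of_lt hz : ρ ≤ ‖z‖)
    · simp [huR z (not_le.1 hzR).le, hq]
  refine ne_top_of_le_ne_top ?_ hle
  rw [lintegral_indicator Metric.isClosed_closedBall.measurableSet, setLIntegral_const]
  exact ENNReal.mul_ne_top (ENNReal.rpow_ne_top_of_nonneg hq.le ENNReal.ofReal_ne_top)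
    measure_closedBall_lt_top.ne

/-- The Sobolev inequality outside a disk, for functions of bounded support. -/
lemma lintegral_rpow_le_lintegral_fderiv_rpow {F : Type*} [NormedAddCommGroup F]
    [InnerProductSpace ℝ F] [CompleteSpace F] {p q : ℝ} (hp : 1 ≤ p) (hq : 1 ≤ q)
    (hpq : 1 - 2 / p = -(2 / q)) {u : EuclideanSpace ℝ (Fin 2) → F} {r R : ℝ}
    (hu : ContDiffOn ℝ 1 u {z | r < ‖z‖}) (huR : ∀ z, R ≤ ‖z‖ → u z = 0) :
    (∫⁻ z in {z | r < ‖z‖}, ‖u z‖ₑ ^ q) ^ (1 / q) ≤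
      ENNReal.ofReal (q / 2) * (∫⁻ z in {z | r < ‖z‖}, ‖fderiv ℝ u z‖ₑ ^ p) ^ (1 / p) := by
  have hq0 : 0 < q := by linarith
  have hp0 : 0 < p := by linarith
  have hunion : {z : EuclideanSpace ℝ (Fin 2) | r < ‖z‖} =
      ⋃ n : ℕ, {z | r + 1 / ((n : ℝ) + 1) < ‖z‖} := by
    ext z
    simp only [mem_ofPred_eq, mem_iUnion]
    constructor
    · intro hz
      obtain ⟨n, hn⟩ := exists_nat_one_div_lt (sub_pos.2 hz)
      exact ⟨n, by linarith⟩
    · rintro ⟨n, hn⟩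
      have : (0 : ℝ) < 1 / ((n : ℝ) + 1) := Nat.one_div_pos_of_nat
      linarith
  have hdir : Directed (· ⊆ ·)
      (fun n : ℕ => {z : EuclideanSpace ℝ (Fin 2) | r + 1 / ((n : ℝ) + 1) < ‖z‖}) := by
    refine directed_of_isDirected_le fun m n hmn z hz => ?_
    have := Nat.one_div_le_one_div (α := ℝ) hmn
    simp only [mem_ofPred_eq] at hz ⊢
    linarith
  rw [one_div q, ENNReal.rpow_inv_le_iff hq0]
  conv_lhs => rw [hunion, setLIntegral_iUnion_of_directed _ hdir]
  refine iSup_le fun n => ?_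
  have hn : r < r + 1 / ((n : ℝ) + 1) := lt_add_of_pos_right r Nat.one_div_pos_of_nat
  have hsub : {z : EuclideanSpace ℝ (Fin 2) | r + 1 / ((n : ℝ) + 1) < ‖z‖} ⊆ {z | r < ‖z‖} :=
    fun z hz => hn.trans hz
  rw [← ENNReal.rpow_inv_le_iff hq0, ← one_div q]
  refine (lintegral_rpow_le_of_lintegral_rpow_ne_top hp hq hpq (hu.mono hsub) huR
    (setLIntegral_enorm_rpow_ne_top hq0 hn hu.continuousOn huR)).trans ?_
  gcongr

lemma enorm_fderiv_eq_zero_of_eventuallyEq {E F : Type*} [NormedAddCommGroup E] [NormedSpace ℝ E]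
    [NormedAddCommGroup F] [NormedSpace ℝ F] {f : E → F} {x : E} (hf : f =ᶠ[nhds x] 0) :
    ‖fderiv ℝ f x‖ₑ = 0 := by
  rw [hf.fderiv_eq, ← ofReal_norm]
  simp

lemma annulus_ae_eq {R r : ℝ} :
    annulus R r =ᵐ[volume] (Metric.ball 0 R ∩ {z | r < ‖z‖} : Set (EuclideanSpace ℝ (Fin 2))) := by
  have h0 : ∀ᵐ z : EuclideanSpace ℝ (Fin 2), z ≠ 0 := by
    simp [ae_iff, measure_singleton]
  refine Filter.eventuallyEq_set.2 ?_
  filter_upwards [h0] with z hz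
  refine (and_congr_right fun _ => ⟨fun h => ?_, fun h h' => ?_⟩)
  · by_contra hzr
    have hzr' : ‖z‖ ≤ r := not_lt.1 hzr
    refine h ?_
    rw [closure_ball 0 ((norm_pos_iff.2 hz).trans_le hzr').ne']
    simpa using hzr'
  · exact (not_le.2 h) (by simpa using Metric.closure_ball_subset_closedBall h')

end RaySobolev

/-- **Critical Sobolev inequality on annuli.** If `p, q ≥ 1` satisfy `1 − 2/p = −2/q`, then
for all `R > 0`, `r ∈ [0, R)`, and every smooth `ξ : B_{R,r} → ℝ^k` whose support has closure
(in `ℝ²`) contained in `B_R \ B_r`: `‖ξ‖_q ≤ q ‖dξ‖_p`. -/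
theorem stmt7 (p q : ℝ) (hp : 1 ≤ p) (hq : 1 ≤ q) (hpq : 1 - 2 / p = -(2 / q))
    (k : ℕ) (R r : ℝ) (hR : 0 < R) (hr : r ∈ Set.Ico 0 R)
    (ξ : EuclideanSpace ℝ (Fin 2) → EuclideanSpace ℝ (Fin k))
    (hξ : ContDiffOn ℝ (⊤ : ℕ∞) ξ (annulus R r))
    (hsupp : closure {z | z ∈ annulus R r ∧ ξ z ≠ 0} ⊆
      Metric.ball 0 R \ Metric.ball 0 r) :
    eLpNorm ξ (ENNReal.ofReal q) (volume.restrict (annulus R r)) ≤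
      ENNReal.ofReal q *
        eLpNorm (fun y => fderiv ℝ ξ y) (ENNReal.ofReal p)
          (volume.restrict (annulus R r)) := by
  have hp0 : 0 < p := by linarith
  have hq0 : 0 < q := by linarith
  set B : Set (EuclideanSpace ℝ (Fin 2)) := Metric.ball 0 R with hB
  set V : Set (EuclideanSpace ℝ (Fin 2)) := {z | r < ‖z‖}
  have hVm : MeasurableSet V := (isOpen_lt continuous_const continuous_norm).measurableSet
  have hBm : MeasurableSet B := Metric.isOpen_ball.measurableSet
  have hAopen : IsOpen (annulus R r) := Metric.isOpen_ball.sdiff isClosed_closure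
  have hmemA : ∀ z ∈ V, z ∈ B → z ∈ annulus R r := fun z hz hzB =>
    ⟨hzB, fun h => (not_le.2 hz) (by simpa using Metric.closure_ball_subset_closedBall h)⟩
  set η := B.indicator ξ with hη
  have hηξ : ∀ z ∈ B, η =ᶠ[nhds z] ξ := fun z hz => by
    filter_upwards [Metric.isOpen_ball.mem_nhds hz] with y hy
    exact Set.indicator_of_mem hy ξ
  have hη0 : ∀ z ∈ V, z ∉ B → η =ᶠ[nhds z] 0 := fun z hzV hz => by
    have hcl : z ∉ closure {z | z ∈ annulus R r ∧ ξ z ≠ 0} := fun h => hz (hsupp h).1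
    filter_upwards [isClosed_closure.isOpen_compl.mem_nhds hcl,
      (isOpen_lt continuous_const continuous_norm).mem_nhds hzV] with y hy hyV
    by_cases hyB : y ∈ B
    · by_contra hne
      refine hy (subset_closure ⟨hmemA y hyV hyB, ?_⟩)
      rwa [hη, Set.indicator_of_mem hyB] at hne
    · exact Set.indicator_of_notMem hyB ξ
  have hηC : ContDiffOn ℝ 1 η V := fun z hz => by
    by_cases hzB : z ∈ B
    · have h1 : ContDiffAt ℝ 1 ξ z :=
        (hξ.contDiffAt (hAopen.mem_nhds (hmemA z hz hzB))).of_le (by exact_mod_cast le_top)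
      exact (h1.congr_of_eventuallyEq (hηξ z hzB)).contDiffWithinAt
    · exact (contDiffAt_const.congr_of_eventuallyEq (hη0 z hz hzB)).contDiffWithinAt
  have hηR : ∀ z, R ≤ ‖z‖ → η z = 0 := fun z hz =>
    Set.indicator_of_notMem (by simpa [hB] using hz) ξ
  have hmain := lintegral_rpow_le_lintegral_fderiv_rpow hp hq hpq hηC hηR
  rw [Measure.restrict_congr_set annulus_ae_eq,
    eLpNorm_eq_lintegral_rpow_enorm_toReal (by simpa using hq0) ENNReal.ofReal_ne_top,
    eLpNorm_eq_lintegral_rpow_enorm_toReal (by simpa using hp0) ENNReal.ofReal_ne_top,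
    ENNReal.toReal_ofReal hp0.le, ENNReal.toReal_ofReal hq0.le]
  have hleft : ∫⁻ z in B ∩ V, ‖ξ z‖ₑ ^ q ≤ ∫⁻ z in V, ‖η z‖ₑ ^ q := by
    refine le_trans (setLIntegral_mono' (hBm.inter hVm) fun z hz => ?_)
      (lintegral_mono_set Set.inter_subset_right)
    rw [hη, Set.indicator_of_mem hz.1]
  have hright : ∫⁻ z in V, ‖fderiv ℝ η z‖ₑ ^ p ≤ ∫⁻ z in B ∩ V, ‖fderiv ℝ ξ z‖ₑ ^ p := by
    rw [← setLIntegral_indicator hBm]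
    refine setLIntegral_mono' hVm fun z hz => ?_
    by_cases hzB : z ∈ B
    · rw [Set.indicator_of_mem hzB, (hηξ z hzB).fderiv_eq]
    · have : ‖fderiv ℝ η z‖ₑ = 0 := enorm_fderiv_eq_zero_of_eventuallyEq (hη0 z hz hzB)
      rw [this, ENNReal.zero_rpow_of_pos hp0]
      exact zero_le
  calc _ ≤ (∫⁻ z in V, ‖η z‖ₑ ^ q) ^ (1 / q) := by gcongr
    _ ≤ _ := hmain
    _ ≤ _ := by
        gcongr
        linarith
end

section
/- There exists a universal constant C > 0 with the following property: for all R > 0, r ∈ [0, R], and every smooth function ζ : B_{R,r} → ℝ^k with ∫_{B_{R,r}} ζ = 0, one has ‖ζ‖₁ ≤ C · R² · ‖dζ‖₂. (In particular, the constant can be taken independent of the ratio R/r, and C = 125√(2π)/4 suffices.) -/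
open MeasureTheory Real

/-- The unit vector of the Euclidean plane at angle `θ`. -/
noncomputable def circleVec (θ : ℝ) : EuclideanSpace ℝ (Fin 2) := !₂[cos θ, sin θ]

/-- Lebesgue measure on the parameter rectangle `(r, R) × (-π, π)` of the annulus. -/
noncomputable def polarRect (R r : ℝ) : Measure (ℝ × ℝ) :=
  (volume.restrict (Set.Ioo r R)).prod (volume.restrict (Set.Ioo (-π) π))

instance isFiniteMeasure_polarRect (R r : ℝ) : IsFiniteMeasure (polarRect R r) := by
  unfold polarRect
  infer_instance

theorem polarRect_univ (R r : ℝ) :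
    polarRect R r Set.univ = ENNReal.ofReal (R - r) * ENNReal.ofReal (2 * π) := by
  rw [polarRect, ← Set.univ_prod_univ, Measure.prod_prod]
  simp only [Measure.restrict_apply_univ, Real.volume_Ioo]
  ring_nf

theorem hasDerivAt_circleVec (θ : ℝ) : HasDerivAt circleVec (!₂[-sin θ, cos θ]) θ := by
  have h : HasDerivAt (fun t => ![cos t, sin t]) ![-sin θ, cos θ] θ := by
    rw [hasDerivAt_pi]
    intro i
    fin_cases i
    · exact hasDerivAt_cos θ
    · exact hasDerivAt_sin θ
  exact (PiLp.continuousLinearEquiv 2 ℝ (fun _ : Fin 2 => ℝ)).symm.hasFDerivAt.comp_hasDerivAt θ h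

theorem contDiff_circleVec : ContDiff ℝ 1 circleVec := by
  rw [contDiff_euclidean]
  intro i
  fin_cases i
  · exact contDiff_cos
  · exact contDiff_sin

theorem continuous_circleVec : Continuous circleVec := contDiff_circleVec.continuous

theorem norm_circleVec (θ : ℝ) : ‖circleVec θ‖ = 1 := by
  simp [circleVec, EuclideanSpace.norm_eq]

theorem norm_deriv_circleVec (θ : ℝ) : ‖deriv circleVec θ‖ = 1 := by
  simp [(hasDerivAt_circleVec θ).deriv, EuclideanSpace.norm_eq]

theorem smul_circleVec_mem_annulus {R r ρ : ℝ} (hr : 0 ≤ r) (hρ : 0 < ρ) (θ : ℝ) :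
    ρ • circleVec θ ∈ annulus R r ↔ ρ ∈ Set.Ioo r R := by
  have hn : ‖ρ • circleVec θ‖ = ρ := by
    rw [norm_smul, norm_circleVec, mul_one, Real.norm_of_nonneg hρ.le]
  rcases hr.eq_or_lt with rfl | hr
  · simp [annulus, hn, hρ, -Metric.mem_ball, mem_ball_zero_iff]
  · rw [annulus, closure_ball _ hr.ne', Set.mem_sdiff, mem_ball_zero_iff, mem_closedBall_zero_iff,
      hn, not_le, Set.mem_Ioo, and_comm]

theorem setLIntegral_annulus {R r : ℝ} (hr : 0 ≤ r)
    (h : EuclideanSpace ℝ (Fin 2) → ENNReal) :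
    ∫⁻ x in annulus R r, h x =
      ∫⁻ p, ENNReal.ofReal p.1 * h (p.1 • circleVec p.2) ∂(polarRect R r) := by
  have hmp := Complex.orthonormalBasisOneI.measurePreserving_repr
  have hsub : Set.Ioo r R ×ˢ Set.Ioo (-π) π ⊆ polarCoord.target :=
    Set.prod_mono (fun x hx => hr.trans_lt hx.1) le_rfl
  have hP (p : ℝ × ℝ) : Complex.orthonormalBasisOneI.repr (Complex.polarCoord.symm p) =
      p.1 • circleVec p.2 := by
    ext i
    fin_cases i
    · simp [Complex.orthonormalBasisOneI_repr_apply, circleVec, -Complex.ofReal_cos]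
    · simp [Complex.orthonormalBasisOneI_repr_apply, circleVec, -Complex.ofReal_sin]
  rw [← lintegral_indicator (isOpen_annulus R r).measurableSet,
    ← hmp.lintegral_comp_emb
      (Complex.orthonormalBasisOneI.repr.toHomeomorph.measurableEmbedding),
    ← Complex.lintegral_comp_polarCoord_symm, polarRect, Measure.prod_restrict,
    ← Measure.volume_eq_prod,
    ← lintegral_indicator (measurableSet_Ioo.prod measurableSet_Ioo),
    ← lintegral_indicator polarCoord.open_target.measurableSet]
  congr 1
  ext p
  by_cases hp : p ∈ polarCoord.target
  · rw [Set.indicator_of_mem hp, hP]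
    have hmem : p.1 • circleVec p.2 ∈ annulus R r ↔ p ∈ Set.Ioo r R ×ˢ Set.Ioo (-π) π := by
      rw [smul_circleVec_mem_annulus hr hp.1, Set.mem_prod]
      exact ⟨fun h => ⟨h, hp.2⟩, fun h => h.1⟩
    by_cases hq : p ∈ Set.Ioo r R ×ˢ Set.Ioo (-π) π
    · rw [Set.indicator_of_mem hq, Set.indicator_of_mem (hmem.2 hq), smul_eq_mul]
    · rw [Set.indicator_of_notMem hq, Set.indicator_of_notMem (mt hmem.1 hq), smul_zero]
  · rw [Set.indicator_of_notMem hp, Set.indicator_of_notMem (fun h => hp (hsub h))]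

theorem volume_annulus_le {R r : ℝ} (hR : 0 ≤ R) :
    volume (annulus R r) ≤ ENNReal.ofReal (π * R ^ 2) := by
  refine (measure_mono Set.sdiff_subset).trans_eq ?_
  rw [EuclideanSpace.volume_ball_fin_two, ← ENNReal.ofReal_pow hR,
    ← ENNReal.ofReal_mul (by positivity), mul_comm]

theorem le_volume_annulus {R r : ℝ} (hr : 0 ≤ r) (hrR : r ≤ R) :
    ENNReal.ofReal (π * (R - r) ^ 2) ≤ volume (annulus R r) := by
  have hR := hr.trans hrR
  calc ENNReal.ofReal (π * (R - r) ^ 2)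
      ≤ ENNReal.ofReal (R ^ 2 * π - r ^ 2 * π) := by
        apply ENNReal.ofReal_le_ofReal
        nlinarith [mul_nonneg pi_pos.le (mul_nonneg hr (sub_nonneg.2 hrR))]
    _ = volume (Metric.ball (0 : EuclideanSpace ℝ (Fin 2)) R) -
          volume (Metric.closedBall (0 : EuclideanSpace ℝ (Fin 2)) r) := by
        rw [EuclideanSpace.volume_ball_fin_two, EuclideanSpace.volume_closedBall_fin_two,
          ENNReal.ofReal_sub _ (by positivity), ENNReal.ofReal_mul (by positivity),
          ENNReal.ofReal_mul (by positivity), ENNReal.ofReal_pow hR, ENNReal.ofReal_pow hr]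
    _ ≤ volume (annulus R r) :=
        le_measure_sdiff.trans (measure_mono
          (Set.sdiff_subset_sdiff_right Metric.closure_ball_subset_closedBall))

section Difference

variable {E F : Type*} [NormedAddCommGroup E] [NormedSpace ℝ E] [NormedAddCommGroup F]
  [NormedSpace ℝ F]

theorem enorm_sub_le_lintegral_fderiv_comp {U : Set E} (hU : IsOpen U) {f : E → F}
    (hf : ContDiffOn ℝ 1 f U) {γ : ℝ → E} (hγ : ContDiff ℝ 1 γ) (a b : ℝ)
    (hmaps : Set.MapsTo γ (Set.uIcc a b) U) :
    ‖f (γ b) - f (γ a)‖ₑ ≤ ∫⁻ t in Set.uIcc a b, ‖fderiv ℝ f (γ t)‖ₑ * ‖deriv γ t‖ₑ := by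
  wlog hab : a ≤ b generalizing a b
  · rw [← enorm_neg, neg_sub, Set.uIcc_comm]
    exact this b a (Set.uIcc_comm a b ▸ hmaps) (le_of_not_ge hab)
  rw [Set.uIcc_of_le hab] at hmaps ⊢
  refine (enorm_sub_le_lintegral_deriv_of_contDiffOn_Icc
    (f := f ∘ γ) (hf.comp hγ.contDiffOn hmaps) hab).trans ?_
  refine setLIntegral_mono' measurableSet_Icc fun t ht => ?_
  have hfd : DifferentiableAt ℝ f (γ t) :=
    (hf.contDiffAt (hU.mem_nhds (hmaps ht))).differentiableAt one_ne_zero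
  rw [(hfd.hasFDerivAt.comp_hasDerivAt t
    (hγ.differentiable one_ne_zero t).hasDerivAt).deriv]
  exact ContinuousLinearMap.le_opENorm _ _

end Difference

variable {F : Type*} [NormedAddCommGroup F] [NormedSpace ℝ F]

theorem enorm_sub_le_angular {R r ρ θ φ : ℝ} (hr : 0 ≤ r) (hρ : ρ ∈ Set.Ioo r R)
    (hθ : θ ∈ Set.Ioo (-π) π) (hφ : φ ∈ Set.Ioo (-π) π) {f : EuclideanSpace ℝ (Fin 2) → F}
    (hf : ContDiffOn ℝ 1 f (annulus R r)) :
    ‖f (ρ • circleVec θ) - f (ρ • circleVec φ)‖ₑ ≤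
      ∫⁻ t in Set.Ioo (-π) π, ENNReal.ofReal ρ * ‖fderiv ℝ f (ρ • circleVec t)‖ₑ := by
  have hρ0 : 0 < ρ := hr.trans_lt hρ.1
  refine (enorm_sub_le_lintegral_fderiv_comp (isOpen_annulus R r) hf
    (γ := fun t => ρ • circleVec t) (contDiff_circleVec.const_smul ρ) φ θ
    fun t _ => (smul_circleVec_mem_annulus hr hρ0 t).2 hρ).trans ?_
  refine (lintegral_mono_set (Set.ordConnected_Ioo.uIcc_subset hφ hθ)).trans_eq ?_
  refine lintegral_congr fun t => ?_
  rw [deriv_fun_const_smul _ (hasDerivAt_circleVec t).differentiableAt, enorm_smul,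
    ← ofReal_norm (deriv circleVec t), norm_deriv_circleVec, Real.enorm_of_nonneg hρ0.le,
    ENNReal.ofReal_one, mul_one, mul_comm]

theorem enorm_sub_le_radial {R r ρ σ φ : ℝ} (hr : 0 ≤ r) (hρ : ρ ∈ Set.Ioo r R)
    (hσ : σ ∈ Set.Ioo r R) {f : EuclideanSpace ℝ (Fin 2) → F}
    (hf : ContDiffOn ℝ 1 f (annulus R r)) :
    ENNReal.ofReal ρ * ENNReal.ofReal σ * ‖f (ρ • circleVec φ) - f (σ • circleVec φ)‖ₑ ≤
      ENNReal.ofReal R *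
        ∫⁻ s in Set.Ioo r R, ENNReal.ofReal s * ‖fderiv ℝ f (s • circleVec φ)‖ₑ := by
  have hsub : Set.uIcc σ ρ ⊆ Set.Ioo r R := Set.ordConnected_Ioo.uIcc_subset hσ hρ
  have hρ0 : 0 < ρ := hr.trans_lt hρ.1
  have hσ0 : 0 < σ := hr.trans_lt hσ.1
  have h := enorm_sub_le_lintegral_fderiv_comp (isOpen_annulus R r) hf
    (γ := fun s => s • circleVec φ) (contDiff_id.smul contDiff_const) σ ρ
    fun s hs => (smul_circleVec_mem_annulus hr (hr.trans_lt (hsub hs).1) φ).2 (hsub hs)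
  calc _ ≤ ENNReal.ofReal ρ * ENNReal.ofReal σ *
        ∫⁻ s in Set.uIcc σ ρ, ‖fderiv ℝ f (s • circleVec φ)‖ₑ := by
        gcongr
        refine h.trans_eq (lintegral_congr fun s => ?_)
        rw [((hasDerivAt_id' s).smul_const (circleVec φ)).deriv, one_smul,
          ← ofReal_norm (circleVec φ), norm_circleVec, ENNReal.ofReal_one, mul_one]
    _ = ∫⁻ s in Set.uIcc σ ρ,
          ENNReal.ofReal (ρ * σ) * ‖fderiv ℝ f (s • circleVec φ)‖ₑ := by
        rw [← ENNReal.ofReal_mul hρ0.le, lintegral_const_mul' _ _ ENNReal.ofReal_ne_top]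
    _ ≤ ∫⁻ s in Set.uIcc σ ρ,
          ENNReal.ofReal (R * s) * ‖fderiv ℝ f (s • circleVec φ)‖ₑ := by
        refine setLIntegral_mono' measurableSet_uIcc fun s hs => ?_
        refine mul_le_mul_left (ENNReal.ofReal_le_ofReal ?_) _
        have hs0 : 0 < s := hr.trans_lt (hsub hs).1
        rcases Set.mem_uIcc.1 hs with hs | hs
        · rw [mul_comm R, mul_comm ρ]
          exact mul_le_mul hs.1 hρ.2.le hρ0.le hs0.le
        · rw [mul_comm R]
          exact mul_le_mul hs.1 hσ.2.le hσ0.le hs0.le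
    _ ≤ ∫⁻ s in Set.Ioo r R,
          ENNReal.ofReal (R * s) * ‖fderiv ℝ f (s • circleVec φ)‖ₑ := lintegral_mono_set hsub
    _ = _ := by
        simp_rw [ENNReal.ofReal_mul (hρ0.trans hρ.2).le, mul_assoc]
        rw [lintegral_const_mul' _ _ ENNReal.ofReal_ne_top]

theorem ae_polarRect (R r : ℝ) :
    ∀ᵐ p ∂(polarRect R r), p ∈ Set.Ioo r R ×ˢ Set.Ioo (-π) π := by
  rw [polarRect, Measure.prod_restrict]
  exact ae_restrict_mem (measurableSet_Ioo.prod measurableSet_Ioo)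

/-- If `f` has mean zero, its `L¹` norm is controlled by its mean oscillation. -/
theorem lintegral_enorm_mul_measure_le_of_integral_eq_zero {α : Type*} [MeasurableSpace α]
    [CompleteSpace F] {μ : Measure α} [IsFiniteMeasure μ] {f : α → F} (hf : Integrable f μ)
    (h0 : ∫ x, f x ∂μ = 0) :
    (∫⁻ x, ‖f x‖ₑ ∂μ) * μ Set.univ ≤ ∫⁻ x, ∫⁻ y, ‖f x - f y‖ₑ ∂μ ∂μ := by
  rw [← lintegral_mul_const' _ _ (measure_ne_top μ _)]
  refine lintegral_mono fun x => ?_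
  calc ‖f x‖ₑ * μ Set.univ = ‖∫ y, (f x - f y) ∂μ‖ₑ := by
        rw [integral_sub (integrable_const _) hf, h0, sub_zero, integral_const, enorm_smul,
          Real.enorm_of_nonneg measureReal_nonneg, ofReal_measureReal, mul_comm]
    _ ≤ _ := enorm_integral_le_lintegral_enorm _

theorem lintegral_oscillation_annulus_le [CompleteSpace F] {R r : ℝ} (hr : 0 ≤ r) (hrR : r ≤ R)
    {f : EuclideanSpace ℝ (Fin 2) → F} (hf : ContDiffOn ℝ 1 f (annulus R r)) :
    ∫⁻ x in annulus R r, ∫⁻ y in annulus R r, ‖f x - f y‖ₑ ≤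
      ENNReal.ofReal ((2 * π + 2) * R) * (∫⁻ x in annulus R r, ‖fderiv ℝ f x‖ₑ) *
        volume (annulus R r) := by
  have hR := hr.trans hrR
  set g : EuclideanSpace ℝ (Fin 2) → ENNReal := fun x => ‖fderiv ℝ f x‖ₑ with hg
  have hgm : Measurable g := (measurable_fderiv ℝ f).enorm
  have hP : Measurable fun p : ℝ × ℝ => p.1 • circleVec p.2 :=
    (continuous_fst.smul (continuous_circleVec.comp continuous_snd)).measurable
  set lam := polarRect R r with hlam
  set N := ∫⁻ x in annulus R r, g x with hN
  set m := volume (annulus R r) with hm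
  have hNpolar : N = ∫⁻ p, ENNReal.ofReal p.1 * g (p.1 • circleVec p.2) ∂lam :=
    setLIntegral_annulus hr g
  have hmpolar : ∫⁻ p, ENNReal.ofReal p.1 ∂lam = m := by
    simpa using (setLIntegral_annulus (R := R) hr 1).symm
  have hD : Measurable fun p : ℝ × ℝ => ENNReal.ofReal p.1 * g (p.1 • circleVec p.2) :=
    (ENNReal.measurable_ofReal.comp measurable_fst).mul (hgm.comp hP)
  set G : ℝ → ENNReal := fun ρ =>
    ∫⁻ t in Set.Ioo (-π) π, ENNReal.ofReal ρ * g (ρ • circleVec t) with hG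
  set H : ℝ → ENNReal := fun φ =>
    ∫⁻ s in Set.Ioo r R, ENNReal.ofReal s * g (s • circleVec φ) with hH
  have hGm : Measurable G := hD.lintegral_prod_right'
  have hHm : Measurable H := hD.lintegral_prod_left'
  have hGint : ∫⁻ ρ in Set.Ioo r R, G ρ = N := by
    rw [hNpolar, hlam, polarRect, lintegral_prod _ hD.aemeasurable]
  have hHint : ∫⁻ φ in Set.Ioo (-π) π, H φ = N := by
    rw [hNpolar, hlam, polarRect, lintegral_prod_symm _ hD.aemeasurable]
  have hGlam : ∫⁻ p, ENNReal.ofReal p.1 * G p.1 ∂lam ≤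
      ENNReal.ofReal (2 * π * R) * N := by
    calc _ ≤ ∫⁻ p, ENNReal.ofReal R * G p.1 ∂lam := by
          refine lintegral_mono_ae ?_
          filter_upwards [ae_polarRect R r] with p hp
          gcongr
          exact hp.1.2.le
      _ = ENNReal.ofReal R * (ENNReal.ofReal (2 * π) * N) := by
          rw [lintegral_const_mul' _ _ ENNReal.ofReal_ne_top, hlam, polarRect,
            lintegral_prod (fun p => G p.1) (hGm.comp measurable_fst).aemeasurable]
          simp only [lintegral_const, Measure.restrict_apply_univ, Real.volume_Ioo]
          rw [lintegral_mul_const _ hGm, hGint, mul_comm N]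
          ring_nf
      _ = _ := by
          rw [← mul_assoc, ← ENNReal.ofReal_mul hR, mul_comm R]
  have hHlam : ∫⁻ q, H q.2 ∂lam = ENNReal.ofReal (R - r) * N := by
    rw [hlam, polarRect, lintegral_prod (fun q => H q.2) (hHm.comp measurable_snd).aemeasurable]
    simp only [lintegral_const, Measure.restrict_apply_univ, Real.volume_Ioo]
    rw [hHint, mul_comm]
  have hosc : ∀ᵐ p ∂lam, ∀ᵐ q ∂lam,
      ENNReal.ofReal p.1 *
          (ENNReal.ofReal q.1 * ‖f (p.1 • circleVec p.2) - f (q.1 • circleVec q.2)‖ₑ) ≤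
        ENNReal.ofReal p.1 * G p.1 * ENNReal.ofReal q.1 + ENNReal.ofReal R * H q.2 := by
    filter_upwards [ae_polarRect R r] with p hp
    filter_upwards [ae_polarRect R r] with q hq
    calc _ ≤ ENNReal.ofReal p.1 * (ENNReal.ofReal q.1 *
          (‖f (p.1 • circleVec p.2) - f (p.1 • circleVec q.2)‖ₑ +
            ‖f (p.1 • circleVec q.2) - f (q.1 • circleVec q.2)‖ₑ)) := by
          gcongr
          rw [← sub_add_sub_cancel _ (f (p.1 • circleVec q.2)) _]
          exact enorm_add_le _ _
      _ = ENNReal.ofReal p.1 * ‖f (p.1 • circleVec p.2) - f (p.1 • circleVec q.2)‖ₑ *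
            ENNReal.ofReal q.1 + ENNReal.ofReal p.1 * ENNReal.ofReal q.1 *
            ‖f (p.1 • circleVec q.2) - f (q.1 • circleVec q.2)‖ₑ := by ring
      _ ≤ _ := by
          refine add_le_add ?_ (enorm_sub_le_radial hr hp.1 hq.1 hf)
          gcongr
          exact enorm_sub_le_angular hr hp.1 hp.2 hq.2 hf
  have hinner (x : EuclideanSpace ℝ (Fin 2)) := setLIntegral_annulus (R := R) hr
    fun y => ‖f x - f y‖ₑ
  calc _ = ∫⁻ p, ∫⁻ q, ENNReal.ofReal p.1 *
          (ENNReal.ofReal q.1 * ‖f (p.1 • circleVec p.2) - f (q.1 • circleVec q.2)‖ₑ)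
          ∂lam ∂lam := by
        rw [setLIntegral_annulus hr]
        refine lintegral_congr fun p => ?_
        rw [hinner, lintegral_const_mul' _ _ ENNReal.ofReal_ne_top]
    _ ≤ ∫⁻ p, ∫⁻ q, (ENNReal.ofReal p.1 * G p.1 * ENNReal.ofReal q.1 +
          ENNReal.ofReal R * H q.2) ∂lam ∂lam :=
        lintegral_mono_ae (hosc.mono fun p hp => lintegral_mono_ae hp)
    _ = (∫⁻ p, ENNReal.ofReal p.1 * G p.1 ∂lam) * m +
          ENNReal.ofReal R * (ENNReal.ofReal (R - r) * N) * lam Set.univ := by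
        have hq1 : Measurable fun q : ℝ × ℝ => ENNReal.ofReal q.1 :=
          ENNReal.measurable_ofReal.comp measurable_fst
        have hin (p : ℝ × ℝ) : ∫⁻ q, (ENNReal.ofReal p.1 * G p.1 * ENNReal.ofReal q.1 +
            ENNReal.ofReal R * H q.2) ∂lam = ENNReal.ofReal p.1 * G p.1 * m +
              ENNReal.ofReal R * (ENNReal.ofReal (R - r) * N) := by
          rw [lintegral_add_left (hq1.const_mul _), lintegral_const_mul _ hq1,
            lintegral_const_mul' _ _ ENNReal.ofReal_ne_top, hmpolar, hHlam]
        have hp : Measurable fun p : ℝ × ℝ => ENNReal.ofReal p.1 * G p.1 :=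
          hq1.mul (hGm.comp measurable_fst)
        simp_rw [hin]
        rw [lintegral_add_left (hp.mul_const _), lintegral_mul_const _ hp, lintegral_const]
    _ ≤ ENNReal.ofReal (2 * π * R) * N * m + ENNReal.ofReal (2 * R) * N * m := by
        refine add_le_add (mul_le_mul_left hGlam _) ?_
        calc _ = ENNReal.ofReal (2 * R) * N * ENNReal.ofReal (π * (R - r) ^ 2) := by
              rw [hlam, polarRect_univ, ENNReal.ofReal_mul zero_le_two,
                ENNReal.ofReal_mul zero_le_two, ENNReal.ofReal_mul pi_pos.le,
                ENNReal.ofReal_pow (sub_nonneg.2 hrR)]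
              ring
          _ ≤ _ := by
              gcongr
              exact le_volume_annulus hr hrR
    _ = _ := by
        rw [add_mul (2 * π), ENNReal.ofReal_add (by positivity) (by positivity)]
        ring

theorem lintegral_enorm_annulus_le [CompleteSpace F] {R r : ℝ} (hr : 0 ≤ r) (hrR : r < R)
    {f : EuclideanSpace ℝ (Fin 2) → F} (hf : ContDiffOn ℝ 1 f (annulus R r))
    (hi : IntegrableOn f (annulus R r)) (h0 : ∫ x in annulus R r, f x = 0) :
    ∫⁻ x in annulus R r, ‖f x‖ₑ ≤
      ENNReal.ofReal ((2 * π + 2) * R) * ∫⁻ x in annulus R r, ‖fderiv ℝ f x‖ₑ := by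
  have hR : 0 < R := hr.trans_lt hrR
  have hfin : volume (annulus R r) ≠ ⊤ :=
    ne_top_of_le_ne_top ENNReal.ofReal_ne_top (volume_annulus_le hR.le)
  have hpos : volume (annulus R r) ≠ 0 := by
    refine (lt_of_lt_of_le (ENNReal.ofReal_pos.2 ?_) (le_volume_annulus hr hrR.le)).ne'
    have := sub_pos.2 hrR
    positivity
  have : IsFiniteMeasure (volume.restrict (annulus R r)) :=
    isFiniteMeasure_restrict.2 hfin
  have h := (lintegral_enorm_mul_measure_le_of_integral_eq_zero hi h0).trans
    (lintegral_oscillation_annulus_le hr hrR.le hf)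
  rw [Measure.restrict_apply_univ] at h
  exact (ENNReal.mul_le_mul_iff_left hpos hfin).1 h

theorem lintegral_enorm_fderiv_annulus_le [CompleteSpace F] {R r : ℝ} (hR : 0 ≤ R)
    (f : EuclideanSpace ℝ (Fin 2) → F) :
    ∫⁻ x in annulus R r, ‖fderiv ℝ f x‖ₑ ≤ ENNReal.ofReal (√π * R) *
      eLpNorm (fderiv ℝ f) 2 (volume.restrict (annulus R r)) := by
  rw [← eLpNorm_one_eq_lintegral_enorm, ← eLpNorm_norm, ← eLpNorm_norm (fderiv ℝ f)]
  refine (eLpNorm_le_eLpNorm_mul_rpow_measure_univ one_le_two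
    (measurable_fderiv ℝ f).norm.aestronglyMeasurable).trans ?_
  rw [mul_comm, Measure.restrict_apply_univ]
  gcongr
  have he : 1 / (1 : ENNReal).toReal - 1 / (2 : ENNReal).toReal = 1 / 2 := by norm_num
  rw [he]
  refine (ENNReal.rpow_le_rpow (volume_annulus_le hR) (by norm_num)).trans_eq ?_
  rw [ENNReal.ofReal_rpow_of_nonneg (by positivity) (by norm_num), ← Real.sqrt_eq_rpow,
    Real.sqrt_mul pi_pos.le, Real.sqrt_sq hR]

/-- **Poincaré inequality on annuli with a universal constant.** There is `C > 0` so that for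
all `R > 0`, `r ∈ [0, R]`, and every smooth `ζ : B_{R,r} → ℝ^k` with `∫_{B_{R,r}} ζ = 0`:
`‖ζ‖₁ ≤ C R² ‖dζ‖₂`. -/
theorem stmt8 :
    ∃ C : ℝ, 0 < C ∧
      ∀ (k : ℕ) (R r : ℝ), 0 < R → r ∈ Set.Icc 0 R →
        ∀ ζ : EuclideanSpace ℝ (Fin 2) → EuclideanSpace ℝ (Fin k),
          ContDiffOn ℝ (⊤ : ℕ∞) ζ (annulus R r) →
          IntegrableOn ζ (annulus R r) →
          (∫ y in annulus R r, ζ y) = 0 →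
          eLpNorm ζ 1 (volume.restrict (annulus R r)) ≤
            ENNReal.ofReal (C * R ^ 2) *
              eLpNorm (fun y => fderiv ℝ ζ y) 2 (volume.restrict (annulus R r)) := by
  refine ⟨(2 * π + 2) * √π, by positivity, fun k R r hR hr ζ hζ hi h0 => ?_⟩
  rcases hr.2.eq_or_lt with rfl | hrR
  · have hempty : annulus r r = ∅ := Set.sdiff_eq_empty.2 subset_closure
    simp [hempty]
  rw [eLpNorm_one_eq_lintegral_enorm]
  refine (lintegral_enorm_annulus_le hr.1 hrR (hζ.of_le (by exact_mod_cast le_top)) hi h0).trans ?_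
  refine (mul_le_mul_right (lintegral_enorm_fderiv_annulus_le hR.le ζ) _).trans_eq ?_
  rw [← mul_assoc, ← ENNReal.ofReal_mul (by positivity)]
  congr 2
  ring
end
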